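/- arXiv:0808.0368 — 2 statements merged into one kernel-verified Lean document; each statement's English description precedes it below -/
import Mathlib

section
/- (Parabolic Strichartz estimate) There is an absolute constant C > 0 such that: if ψ : [0,∞) × ℝ² → ℝ is smooth, with all derivatives uniformly Schwartz in the space variable, then (∫₀^∞ ‖ψ(s,·)‖_{L^∞_x(ℝ²)}² ds)^{1/2} ≤ C ( ‖ψ(0,·)‖_{L²_x(ℝ²)} + ∫₀^∞ ‖(∂_s ψ − Δψ)(s,·)‖_{L²_x(ℝ²)} ds ). -/
open MeasureTheory

noncomputable section

/-- The heat-time derivative `∂ₛ` of a function of `(s, x₁, x₂)`. -/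
def dS (f : ℝ × ℝ × ℝ → ℝ) (p : ℝ × ℝ × ℝ) : ℝ := fderiv ℝ f p (1, 0, 0)

/-- The spatial derivative `∂_{x₁}`. -/
def dX1 (f : ℝ × ℝ × ℝ → ℝ) (p : ℝ × ℝ × ℝ) : ℝ := fderiv ℝ f p (0, 1, 0)

/-- The spatial derivative `∂_{x₂}`. -/
def dX2 (f : ℝ × ℝ × ℝ → ℝ) (p : ℝ × ℝ × ℝ) : ℝ := fderiv ℝ f p (0, 0, 1)

/-- The spatial Laplacian `Δ = ∂_{x₁}² + ∂_{x₂}²` on `ℝ²`. -/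
def lap (f : ℝ × ℝ × ℝ → ℝ) (p : ℝ × ℝ × ℝ) : ℝ := dX1 (dX1 f) p + dX2 (dX2 f) p

/-- The heat operator `∂ₛ − Δ`. -/
def heatOp (f : ℝ × ℝ × ℝ → ℝ) (p : ℝ × ℝ × ℝ) : ℝ := dS f p - lap f p


lemma ps_cs {α : Type*} [MeasurableSpace α] (μ : Measure α) {f g : α → ENNReal}
    (hf : AEMeasurable f μ) (hg : AEMeasurable g μ) :
    (∫⁻ a, f a * g a ∂μ) ≤ (∫⁻ a, f a ^ 2 ∂μ) ^ (1/2:ℝ) * (∫⁻ a, g a ^ 2 ∂μ) ^ (1/2:ℝ) := by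
  have h := ENNReal.lintegral_mul_le_Lp_mul_Lq μ Real.HolderConjugate.two_two hf hg
  simpa only [Pi.mul_apply, ENNReal.rpow_two] using h

lemma ps_half_sq (x : ENNReal) : (x ^ (1/2:ℝ)) ^ 2 = x := by
  rw [← ENNReal.rpow_two, ← ENNReal.rpow_mul]; norm_num

lemma ps_sq_half (x : ENNReal) : (x ^ 2) ^ (1/2:ℝ) = x := by
  rw [← ENNReal.rpow_two, ← ENNReal.rpow_mul]; norm_num

lemma ps_cs_sq {α : Type*} [MeasurableSpace α] (μ : Measure α) {f g : α → ENNReal}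
    (hf : AEMeasurable f μ) (hg : AEMeasurable g μ) :
    (∫⁻ a, f a * g a ∂μ) ^ 2 ≤ (∫⁻ a, f a ^ 2 ∂μ) * (∫⁻ a, g a ^ 2 ∂μ) := by
  calc _ ≤ _ := pow_le_pow_left' (ps_cs μ hf hg) 2
    _ = _ := by rw [mul_pow, ps_half_sq, ps_half_sq]

/-- Minkowski's integral inequality for `p = 2`. -/
lemma ps_mink {α β : Type*} [MeasurableSpace α] [MeasurableSpace β] (μ : Measure α)
    (ν : Measure β) [SFinite μ] [SFinite ν] {u : α → β → ENNReal}
    (hu : Measurable (Function.uncurry u)) :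
    (∫⁻ a, (∫⁻ b, u a b ∂ν) ^ 2 ∂μ) ≤ (∫⁻ b, (∫⁻ a, u a b ^ 2 ∂μ) ^ (1/2:ℝ) ∂ν) ^ 2 := by
  have m1 : ∀ b, Measurable (fun a => u a b) := fun b => hu.comp (measurable_id.prodMk measurable_const)
  have m2 : ∀ a, Measurable (u a) := fun a => hu.comp measurable_prodMk_left
  have mN : Measurable (fun b => (∫⁻ a, u a b ^ 2 ∂μ) ^ (1/2:ℝ)) := by
    apply Measurable.pow_const
    exact Measurable.lintegral_prod_left' (f := fun p : α × β => u p.1 p.2 ^ 2) (hu.pow_const 2)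
  have mI : Measurable (fun a => ∫⁻ b, u a b ∂ν) := Measurable.lintegral_prod_right' hu
  calc (∫⁻ a, (∫⁻ b, u a b ∂ν) ^ 2 ∂μ)
      = ∫⁻ a, ∫⁻ b, u a b * ∫⁻ b', u a b' ∂ν ∂ν ∂μ := by
        congr 1; ext a
        rw [lintegral_mul_const _ (m2 a), sq]
    _ = ∫⁻ b, ∫⁻ a, u a b * ∫⁻ b', u a b' ∂ν ∂μ ∂ν := by
        apply lintegral_lintegral_swap
        exact (hu.mul (mI.comp measurable_fst)).aemeasurable
    _ = ∫⁻ b, ∫⁻ b', ∫⁻ a, u a b * u a b' ∂μ ∂ν ∂ν := by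
        congr 1; ext b
        rw [← lintegral_lintegral_swap]
        · congr 1; ext a
          rw [lintegral_const_mul _ (m2 a)]
        · exact (((m1 b).comp measurable_fst).mul hu).aemeasurable
    _ ≤ ∫⁻ b, ∫⁻ b', (∫⁻ a, u a b ^ 2 ∂μ) ^ (1/2:ℝ) * (∫⁻ a, u a b' ^ 2 ∂μ) ^ (1/2:ℝ) ∂ν ∂ν := by
        gcongr with b b'
        exact ps_cs μ (m1 b).aemeasurable (m1 b').aemeasurable
    _ = _ := by
        simp_rw [lintegral_const_mul _ mN]
        rw [lintegral_mul_const _ mN, sq]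

/-- heat multiplier -/
def psE (t : ℝ) (ξ : ℂ) : ENNReal := ENNReal.ofReal (Real.exp (-(4 * Real.pi ^ 2 * t * ‖ξ‖ ^ 2)))

lemma psE_meas : Measurable (fun p : ℝ × ℂ => psE p.1 p.2) := by
  unfold psE; fun_prop

lemma ps_int_xi {t : ℝ} (ht : 0 < t) :
    ∫⁻ ξ : ℂ, ENNReal.ofReal (‖ξ‖⁻¹) * psE t ξ
      = ENNReal.ofReal (Real.pi ^ (1/2:ℝ) / 2 * t ^ (-(1/2):ℝ)) := by
  have hpi := Real.pi_pos
  have hb : 0 < 4 * Real.pi ^ 2 * t := by positivity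
  have key := Complex.integral_rpow_mul_exp_neg_mul_rpow (p := 2) (q := -1) (b := 4 * Real.pi ^ 2 * t)
    (by norm_num) (by norm_num) hb
  have e : ∀ ξ : ℂ, ‖ξ‖ ^ (-1:ℝ) * Real.exp (-(4 * Real.pi ^ 2 * t) * ‖ξ‖ ^ (2:ℝ))
      = ‖ξ‖⁻¹ * Real.exp (-(4 * Real.pi ^ 2 * t * ‖ξ‖ ^ 2)) := by
    intro ξ; rw [Real.rpow_neg_one, Real.rpow_two, neg_mul]
  simp_rw [e] at key
  have val : (2 * Real.pi / 2) * (4 * Real.pi ^ 2 * t) ^ (-(-1 + 2) / 2 : ℝ) * Real.Gamma ((-1+2)/2)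
      = Real.pi ^ (1/2:ℝ) / 2 * t ^ (-(1/2):ℝ) := by
    rw [show ((-1+2)/2:ℝ) = 1/2 by norm_num, Real.Gamma_one_half_eq,
      show (-(-1 + 2) / 2 : ℝ) = -(1/2) by norm_num, Real.mul_rpow (by positivity) ht.le,
      show 4 * Real.pi ^ 2 = (2 * Real.pi) ^ (2:ℝ) by rw [Real.rpow_two]; ring,
      ← Real.rpow_mul (by positivity), ← Real.sqrt_eq_rpow]
    norm_num [Real.rpow_neg_one]
    field_simp
  rw [val] at key
  have hint : Integrable (fun ξ : ℂ => ‖ξ‖⁻¹ * Real.exp (-(4 * Real.pi ^ 2 * t * ‖ξ‖ ^ 2))) := by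
    by_contra h
    rw [integral_undef h] at key
    have : 0 < Real.pi ^ (1/2:ℝ) / 2 * t ^ (-(1/2):ℝ) := by positivity
    linarith
  rw [← key, ofReal_integral_eq_lintegral_ofReal hint (Filter.Eventually.of_forall fun ξ => by positivity)]
  congr 1; ext ξ
  rw [psE, ENNReal.ofReal_mul (by positivity)]

lemma ps_int_t {ξ : ℂ} (hξ : ξ ≠ 0) :
    ∫⁻ t in Set.Ioi (0:ℝ), ENNReal.ofReal (Real.pi ^ (1/2:ℝ) / 2 * t ^ (-(1/2):ℝ))
      * (ENNReal.ofReal ‖ξ‖ * psE t ξ) = ENNReal.ofReal (1/4) := by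
  have hpi := Real.pi_pos
  have hn : 0 < ‖ξ‖ := norm_pos_iff.mpr hξ
  have hb : 0 < 4 * Real.pi ^ 2 * ‖ξ‖ ^ 2 := by positivity
  have key := Real.integral_rpow_mul_exp_neg_mul_Ioi (a := 1/2) (r := 4 * Real.pi ^ 2 * ‖ξ‖ ^ 2)
    (by norm_num) hb
  have hv : (1 / (4 * Real.pi ^ 2 * ‖ξ‖ ^ 2)) ^ (1/2:ℝ) * Real.Gamma (1/2)
     = (2 * Real.pi * ‖ξ‖)⁻¹ * Real.pi ^ (1/2:ℝ) := by
    rw [Real.Gamma_one_half_eq, ← Real.sqrt_eq_rpow, ← Real.sqrt_eq_rpow]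
    congr 1
    rw [show 1 / (4 * Real.pi ^ 2 * ‖ξ‖ ^ 2) = ((2 * Real.pi * ‖ξ‖)⁻¹)^2 by field_simp; norm_num]
    exact Real.sqrt_sq (by positivity)
  rw [hv] at key
  have hint : IntegrableOn (fun t : ℝ => t ^ (1/2 - 1 : ℝ) * Real.exp (-(4 * Real.pi ^ 2 * ‖ξ‖ ^ 2 * t))) (Set.Ioi 0) := by
    by_contra h
    rw [integral_undef h] at key
    have : 0 < (2 * Real.pi * ‖ξ‖)⁻¹ * Real.pi ^ (1/2:ℝ) := by positivity
    linarith
  have h2 : ∫⁻ t in Set.Ioi (0:ℝ), ENNReal.ofReal (Real.pi ^ (1/2:ℝ) / 2 * t ^ (-(1/2):ℝ))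
      * (ENNReal.ofReal ‖ξ‖ * psE t ξ) = ∫⁻ t in Set.Ioi (0:ℝ), ENNReal.ofReal
       (Real.pi ^ (1/2:ℝ) / 2 * ‖ξ‖ * (t ^ (1/2 - 1 : ℝ) * Real.exp (-(4 * Real.pi ^ 2 * ‖ξ‖ ^ 2 * t)))) := by
    apply setLIntegral_congr_fun measurableSet_Ioi
    intro t ht
    have ht : 0 < t := ht
    simp only [psE]
    rw [← ENNReal.ofReal_mul (by positivity), ← ENNReal.ofReal_mul (by positivity)]
    congr 1
    rw [show (1/2 - 1 : ℝ) = -(1/2) by norm_num, show 4 * Real.pi ^ 2 * t * ‖ξ‖ ^ 2 = 4 * Real.pi ^ 2 * ‖ξ‖ ^ 2 * t by ring]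
    ring
  rw [h2, ← ofReal_integral_eq_lintegral_ofReal (hint.const_mul _)]
  · rw [integral_const_mul, key]
    congr 1
    rw [← Real.sqrt_eq_rpow]
    field_simp
    rw [Real.sq_sqrt hpi.le]; ring
  · filter_upwards [ae_restrict_mem measurableSet_Ioi] with t ht
    have ht : 0 < t := ht
    simp only [Pi.zero_apply]; positivity

lemma ps_hom {g : ℂ → ENNReal} (hg : Measurable g) :
    ∫⁻ t in Set.Ioi (0:ℝ), (∫⁻ ξ, psE t ξ * g ξ) ^ 2 ≤ ∫⁻ ξ, g ξ ^ 2 := by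
  have mE : ∀ t, Measurable (psE t) := fun t => psE_meas.comp measurable_prodMk_left
  have hne : ∀ᵐ ξ : ℂ, ξ ≠ 0 := by
    simp [ae_iff]
  have step : ∀ t ∈ Set.Ioi (0:ℝ), (∫⁻ ξ, psE t ξ * g ξ) ^ 2 ≤
      ENNReal.ofReal (Real.pi ^ (1/2:ℝ) / 2 * t ^ (-(1/2):ℝ)) * ∫⁻ ξ, (ENNReal.ofReal ‖ξ‖ * psE t ξ) * g ξ ^ 2 := by
    intro t ht
    have h1 : ∫⁻ ξ, psE t ξ * g ξ = ∫⁻ ξ, (ENNReal.ofReal (‖ξ‖⁻¹) * psE t ξ) ^ (1/2:ℝ) *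
        ((ENNReal.ofReal (‖ξ‖) * psE t ξ) ^ (1/2:ℝ) * g ξ) := by
      apply lintegral_congr_ae
      filter_upwards [hne] with ξ hξ
      have hn : 0 < ‖ξ‖ := norm_pos_iff.mpr hξ
      rw [← mul_assoc, ← ENNReal.mul_rpow_of_nonneg _ _ (by norm_num)]
      congr 1
      rw [show ENNReal.ofReal (‖ξ‖⁻¹) * psE t ξ * (ENNReal.ofReal (‖ξ‖) * psE t ξ) =
        (ENNReal.ofReal (‖ξ‖⁻¹) * ENNReal.ofReal (‖ξ‖)) * psE t ξ ^ 2 by ring,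
        ← ENNReal.ofReal_mul (by positivity), inv_mul_cancel₀ hn.ne']
      rw [ENNReal.ofReal_one, one_mul, ps_sq_half]
    have m1 : Measurable (fun ξ : ℂ => (ENNReal.ofReal (‖ξ‖⁻¹) * psE t ξ) ^ (1/2:ℝ)) := by
      have := mE t
      fun_prop
    have m2 : Measurable (fun ξ : ℂ => (ENNReal.ofReal (‖ξ‖) * psE t ξ) ^ (1/2:ℝ) * g ξ) := by
      have := mE t
      fun_prop
    rw [h1]
    refine (ps_cs_sq _ m1.aemeasurable m2.aemeasurable).trans ?_
    simp_rw [mul_pow, ps_half_sq]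
    rw [ps_int_xi ht]
  calc _ ≤ ∫⁻ t in Set.Ioi (0:ℝ), ∫⁻ ξ, ENNReal.ofReal (Real.pi ^ (1/2:ℝ) / 2 * t ^ (-(1/2):ℝ))
        * (ENNReal.ofReal ‖ξ‖ * psE t ξ) * g ξ ^ 2 := by
        refine (setLIntegral_mono' measurableSet_Ioi step).trans (le_of_eq ?_)
        congr 1; ext t
        rw [← lintegral_const_mul]
        · simp_rw [mul_assoc]
        · have := mE t
          fun_prop
    _ = ∫⁻ ξ, ∫⁻ t in Set.Ioi (0:ℝ), ENNReal.ofReal (Real.pi ^ (1/2:ℝ) / 2 * t ^ (-(1/2):ℝ))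
        * (ENNReal.ofReal ‖ξ‖ * psE t ξ) * g ξ ^ 2 := by
        apply lintegral_lintegral_swap
        have := psE_meas
        apply Measurable.aemeasurable
        unfold Function.uncurry
        fun_prop
    _ = ∫⁻ ξ, ENNReal.ofReal (1/4) * g ξ ^ 2 := by
        apply lintegral_congr_ae
        filter_upwards [hne] with ξ hξ
        rw [lintegral_mul_const, ps_int_t hξ]
        have := psE_meas
        have : Measurable (fun t => psE t ξ) := psE_meas.comp (measurable_id.prodMk measurable_const)
        fun_prop
    _ ≤ _ := by
        gcongr with ξ
        calc _ ≤ 1 * g ξ ^ 2 := by gcongr; rw [ENNReal.ofReal_le_one]; norm_num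
          _ = _ := one_mul _

set_option maxHeartbeats 1600000 in
/-- Fourier side estimate for the Duhamel formula. -/
lemma ps_duh {a : ℝ → ℂ → ENNReal} {g : ℂ → ENNReal} {G : ℝ → ℂ → ENNReal}
    (hg : Measurable g) (hG : Measurable (Function.uncurry G))
    (h : ∀ s > 0, ∀ ξ, a s ξ ≤ psE s ξ * g ξ + ∫⁻ r in Set.Ioc 0 s, psE (s - r) ξ * G r ξ) :
    (∫⁻ s in Set.Ioi (0:ℝ), (∫⁻ ξ, a s ξ) ^ 2) ^ (1/2:ℝ) ≤
      (∫⁻ ξ, g ξ ^ 2) ^ (1/2:ℝ) + ∫⁻ r in Set.Ioi (0:ℝ), (∫⁻ ξ, G r ξ ^ 2) ^ (1/2:ℝ) := by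
  set T : ℝ → ENNReal := fun s => ∫⁻ ξ, psE s ξ * g ξ with hT
  set k : ℝ → ℝ → ENNReal := fun s r => Set.indicator {p : ℝ × ℝ | p.2 < p.1}
    (fun p => ∫⁻ ξ, psE (p.1 - p.2) ξ * G p.2 ξ) (s, r) with hk
  have mE := psE_meas
  have mTu : Measurable (Function.uncurry fun s ξ => psE s ξ * g ξ) := by
    unfold Function.uncurry; fun_prop
  have mT : Measurable T := Measurable.lintegral_prod_right' mTu
  have mk3 : Measurable (fun p : (ℝ × ℝ) × ℂ => psE (p.1.1 - p.1.2) p.2 * G p.1.2 p.2) := by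
    apply Measurable.mul
    · exact mE.comp (by fun_prop : Measurable (fun p : (ℝ × ℝ) × ℂ => (p.1.1 - p.1.2, p.2)))
    · exact hG.comp (by fun_prop : Measurable (fun p : (ℝ × ℝ) × ℂ => (p.1.2, p.2)))
  have mk : Measurable (Function.uncurry k) := by
    refine Measurable.indicator ?_ (measurableSet_lt measurable_snd measurable_fst)
    exact Measurable.lintegral_prod_right' mk3
  have mk2 : Measurable (fun s => ∫⁻ r in Set.Ioi (0:ℝ), k s r) := Measurable.lintegral_prod_right' mk
  have step : ∀ s ∈ Set.Ioi (0:ℝ), (∫⁻ ξ, a s ξ) ^ 2 ≤ (T s + ∫⁻ r in Set.Ioi (0:ℝ), k s r) ^ 2 := by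
    intro s hs
    gcongr
    refine (lintegral_mono (h s hs)).trans ?_
    rw [lintegral_add_left]
    · gcongr
      rw [lintegral_lintegral_swap]
      · rw [← restrict_Ioo_eq_restrict_Ioc]
        calc _ = ∫⁻ r in Set.Ioo 0 s, k s r := by
                apply setLIntegral_congr_fun measurableSet_Ioo
                intro r hr
                simp only [hk]
                rw [Set.indicator_of_mem]
                exact hr.2
          _ ≤ _ := lintegral_mono_set Set.Ioo_subset_Ioi_self
      · apply Measurable.aemeasurable
        have m4 : Measurable (fun p : ℂ × ℝ => ((s, p.2), p.1)) := by fun_prop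
        have m5 : Measurable (fun p : ℂ × ℝ => psE (s - p.2) p.1 * G p.2 p.1) := mk3.comp m4
        exact m5
    · exact mTu.comp measurable_prodMk_left
  have hmink := ENNReal.lintegral_Lp_add_le (μ := volume.restrict (Set.Ioi (0:ℝ))) (p := 2)
    mT.aemeasurable mk2.aemeasurable (by norm_num)
  simp only [ENNReal.rpow_two, Pi.add_apply] at hmink
  refine (ENNReal.rpow_le_rpow (setLIntegral_mono' measurableSet_Ioi step) (by norm_num)).trans
    (hmink.trans ?_)
  gcongr
  · exact ps_hom hg
  · refine (ENNReal.rpow_le_rpow (ps_mink _ _ mk) (by norm_num)).trans ?_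
    rw [ps_sq_half]
    apply setLIntegral_mono' measurableSet_Ioi
    intro r hr
    apply ENNReal.rpow_le_rpow _ (by norm_num)
    have hr : 0 < r := hr
    refine le_trans ?_ (ps_hom (g := G r) (hG.comp measurable_prodMk_left))
    calc ∫⁻ s in Set.Ioi 0, k s r ^ 2 ≤ ∫⁻ s, k s r ^ 2 := setLIntegral_le_lintegral _ _
      _ = ∫⁻ s, k (s + r) r ^ 2 := (lintegral_add_right_eq_self (fun s => k s r ^ 2) r).symm
      _ = ∫⁻ s, (Set.Ioi (0:ℝ)).indicator (fun s => (∫⁻ ξ, psE s ξ * G r ξ) ^ 2) s := by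
          congr 1; ext s
          simp only [hk]
          by_cases hs : 0 < s
          · rw [Set.indicator_of_mem, Set.indicator_of_mem]
            · simp
            · exact hs
            · simpa using hs
          · rw [Set.indicator_of_notMem, Set.indicator_of_notMem]
            · simp
            · exact hs
            · simpa using hs
      _ = _ := lintegral_indicator measurableSet_Ioi _

open scoped FourierTransform SchwartzMap LineDeriv

/-- Smooth with all derivatives uniformly Schwartz in space. -/
def PSch (f : ℝ × ℝ × ℝ → ℝ) : Prop :=
  ContDiff ℝ (⊤ : ℕ∞) f ∧ ∀ n N : ℕ, ∃ B : ℝ, ∀ p : ℝ × ℝ × ℝ, 0 ≤ p.1 →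
        ‖p.2‖ ^ N * ‖iteratedFDeriv ℝ n f p‖ ≤ B

lemma PSch.deriv {f : ℝ × ℝ × ℝ → ℝ} (hf : PSch f) (v : ℝ × ℝ × ℝ) :
    PSch (fun p => fderiv ℝ f p v) := by
  have h1 : ContDiff ℝ (⊤ : ℕ∞) (fderiv ℝ f) := hf.1.fderiv_right (by simp)
  refine ⟨h1.clm_apply contDiff_const, fun n N => ?_⟩
  obtain ⟨B, hB⟩ := hf.2 (n+1) N
  refine ⟨‖v‖ * B, fun p hp => ?_⟩
  have h2 : ‖iteratedFDeriv ℝ n (fun p => fderiv ℝ f p v) p‖ ≤ ‖v‖ * ‖iteratedFDeriv ℝ n (fderiv ℝ f) p‖ :=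
    norm_iteratedFDeriv_clm_apply_const (N := ((⊤:ℕ∞) : WithTop ℕ∞)) h1.contDiffAt (by exact_mod_cast le_top)
  rw [norm_iteratedFDeriv_fderiv] at h2
  calc _ ≤ ‖p.2‖ ^ N * (‖v‖ * ‖iteratedFDeriv ℝ (n+1) f p‖) := by gcongr
    _ = ‖v‖ * (‖p.2‖ ^ N * ‖iteratedFDeriv ℝ (n+1) f p‖) := by ring
    _ ≤ _ := by gcongr; exact hB p hp

lemma PSch.lin {f g : ℝ × ℝ × ℝ → ℝ} (hf : PSch f) (hg : PSch g) (c : ℝ) :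
    PSch (fun p => f p + c * g p) := by
  have h2 : ContDiff ℝ (⊤ : ℕ∞) (c • g) := hg.1.const_smul c
  refine ⟨hf.1.add h2, fun n N => ?_⟩
  obtain ⟨B, hB⟩ := hf.2 n N
  obtain ⟨B', hB'⟩ := hg.2 n N
  refine ⟨B + |c| * B', fun p hp => ?_⟩
  have e : iteratedFDeriv ℝ n (fun p => f p + c * g p) p =
      iteratedFDeriv ℝ n f p + c • iteratedFDeriv ℝ n g p := by
    have hn : (n : WithTop ℕ∞) ≤ ((⊤:ℕ∞) : WithTop ℕ∞) := by exact_mod_cast le_top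
    have := iteratedFDeriv_add_apply (𝕜 := ℝ) (i := n) (x := p) (f := f) (g := c • g)
      (hf.1.of_le hn).contDiffAt (h2.of_le hn).contDiffAt
    rw [iteratedFDeriv_const_smul_apply (hg.1.of_le hn).contDiffAt] at this
    exact this
  rw [e]
  calc _ ≤ ‖p.2‖ ^ N * (‖iteratedFDeriv ℝ n f p‖ + |c| * ‖iteratedFDeriv ℝ n g p‖) := by
        gcongr
        refine (norm_add_le _ _).trans ?_
        rw [norm_smul, Real.norm_eq_abs]
    _ = ‖p.2‖ ^ N * ‖iteratedFDeriv ℝ n f p‖ + |c| * (‖p.2‖ ^ N * ‖iteratedFDeriv ℝ n g p‖) := by ring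
    _ ≤ _ := by gcongr; exacts [hB p hp, hB' p hp]

lemma PSch.dS {f : ℝ × ℝ × ℝ → ℝ} (hf : PSch f) : PSch (dS f) := hf.deriv _
lemma PSch.dX1 {f : ℝ × ℝ × ℝ → ℝ} (hf : PSch f) : PSch (dX1 f) := hf.deriv _
lemma PSch.dX2 {f : ℝ × ℝ × ℝ → ℝ} (hf : PSch f) : PSch (dX2 f) := hf.deriv _

lemma PSch.heatOp {f : ℝ × ℝ × ℝ → ℝ} (hf : PSch f) : PSch (heatOp f) := by
  have := hf.dS.lin (hf.dX1.dX1.lin hf.dX2.dX2 1) (-1)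
  have e : _root_.heatOp f = fun p => _root_.dS f p + -1 * (_root_.dX1 (_root_.dX1 f) p + 1 * _root_.dX2 (_root_.dX2 f) p) := by
    ext p; simp only [_root_.heatOp, lap]; ring
  rw [e]; exact this

/-- The embedding of `ℂ` in space-time. -/
def psL : ℂ →L[ℝ] ℝ × ℝ × ℝ :=
  (ContinuousLinearMap.inr ℝ ℝ (ℝ × ℝ)).comp (Complex.equivRealProdCLM : ℂ →L[ℝ] ℝ × ℝ)

lemma psL_apply (x : ℂ) : psL x = (0, x.re, x.im) := by
  simp [psL]

lemma ps_norm_le (x : ℂ) : ‖x‖ ≤ 2 * ‖((x.re, x.im) : ℝ × ℝ)‖ := by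
  have h := Complex.norm_le_abs_re_add_abs_im x
  have h1 : |x.re| ≤ ‖((x.re, x.im) : ℝ × ℝ)‖ := norm_fst_le (x.re, x.im)
  have h2 : |x.im| ≤ ‖((x.re, x.im) : ℝ × ℝ)‖ := norm_snd_le (x.re, x.im)
  linarith

/-- complexified slice -/
def psF (f : ℝ × ℝ × ℝ → ℝ) (s : ℝ) (x : ℂ) : ℂ := (f (s, x.re, x.im) : ℂ)

lemma psF_eq (f : ℝ × ℝ × ℝ → ℝ) (s : ℝ) :
    psF f s = Complex.ofRealCLM ∘ ((fun q => f (q + (s, 0, 0))) ∘ psL) := by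
  ext x; simp [psF, psL_apply]

lemma PSch.contDiff_slice {f : ℝ × ℝ × ℝ → ℝ} (hf : PSch f) (s : ℝ) :
    ContDiff ℝ (⊤ : ℕ∞) (psF f s) := by
  rw [psF_eq]
  exact Complex.ofRealCLM.contDiff.comp ((hf.1.comp (contDiff_id.add contDiff_const)).comp psL.contDiff)

lemma PSch.decay_slice {f : ℝ × ℝ × ℝ → ℝ} (hf : PSch f) (k n : ℕ) :
    ∃ C : ℝ, ∀ s, 0 ≤ s → ∀ x, ‖x‖ ^ k * ‖iteratedFDeriv ℝ n (psF f s) x‖ ≤ C := by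
  obtain ⟨B, hB⟩ := hf.2 n k
  refine ⟨2 ^ k * ‖psL‖ ^ n * B, fun s hs x => ?_⟩
  have hn : (n : WithTop ℕ∞) ≤ ((⊤:ℕ∞) : WithTop ℕ∞) := by exact_mod_cast le_top
  have hsh : ContDiff ℝ (⊤ : ℕ∞) (fun q => f (q + (s, 0, 0))) := hf.1.comp (contDiff_id.add contDiff_const)
  have h1 : ‖iteratedFDeriv ℝ n (psF f s) x‖ ≤ ‖iteratedFDeriv ℝ n f (s, x.re, x.im)‖ * ‖psL‖ ^ n := by
    rw [psF_eq]
    have e1 := LinearIsometry.norm_iteratedFDeriv_comp_left (𝕜 := ℝ) (n := ((⊤:ℕ∞) : WithTop ℕ∞)) (i := n) (x := x)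
      Complex.ofRealLI (f := (fun q => f (q + (s, 0, 0))) ∘ psL) (hsh.comp psL.contDiff).contDiffAt hn
    have e2 := psL.iteratedFDeriv_comp_right hsh x hn
    change ‖iteratedFDeriv ℝ n (⇑Complex.ofRealLI ∘ ((fun q => f (q + (s, 0, 0))) ∘ psL)) x‖ ≤ _
    rw [e1, e2]
    refine (ContinuousMultilinearMap.norm_compContinuousLinearMap_le _ _).trans ?_
    rw [iteratedFDeriv_comp_add_right, psL_apply]
    simp
  have h2 : ‖x‖ ^ k ≤ 2 ^ k * ‖((x.re, x.im) : ℝ × ℝ)‖ ^ k := by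
    rw [← mul_pow]; exact pow_le_pow_left₀ (norm_nonneg _) (ps_norm_le x) k
  calc _ ≤ (2 ^ k * ‖((x.re, x.im) : ℝ × ℝ)‖ ^ k) * (‖iteratedFDeriv ℝ n f (s, x.re, x.im)‖ * ‖psL‖ ^ n) := by gcongr
    _ = 2 ^ k * ‖psL‖ ^ n * (‖((x.re, x.im) : ℝ × ℝ)‖ ^ k * ‖iteratedFDeriv ℝ n f (s, x.re, x.im)‖) := by ring
    _ ≤ _ := by gcongr; exact hB (s, x.re, x.im) hs

/-- slices as Schwartz functions -/
def PSch.slice {f : ℝ × ℝ × ℝ → ℝ} (hf : PSch f) {s : ℝ} (hs : 0 ≤ s) : 𝓢(ℂ, ℂ) where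
  toFun := psF f s
  smooth' := hf.contDiff_slice s
  decay' := fun k n => by
    obtain ⟨C, hC⟩ := hf.decay_slice k n
    exact ⟨C, hC s hs⟩

lemma PSch.slice_coe {f : ℝ × ℝ × ℝ → ℝ} (hf : PSch f) {s : ℝ} (hs : 0 ≤ s) :
    (hf.slice hs : ℂ → ℂ) = psF f s := rfl

lemma PSch.bound {f : ℝ × ℝ × ℝ → ℝ} (hf : PSch f) :
    ∃ C : ℝ, ∀ s, 0 ≤ s → ∀ x, ‖psF f s x‖ ≤ C * (1 + ‖x‖) ^ (-3:ℝ) := by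
  obtain ⟨C0, h0⟩ := hf.decay_slice 0 0
  obtain ⟨C3, h3⟩ := hf.decay_slice 3 0
  refine ⟨4 * (C0 + C3), fun s hs x => ?_⟩
  have a0 := h0 s hs x
  have a3 := h3 s hs x
  rw [norm_iteratedFDeriv_zero] at a0 a3
  have hx := norm_nonneg x
  rw [show (-3:ℝ) = -((3:ℕ):ℝ) by norm_num, Real.rpow_neg (by positivity), Real.rpow_natCast,
    ← div_eq_mul_inv, le_div_iff₀ (by positivity)]
  have : (1 + ‖x‖) ^ 3 ≤ 4 * (1 + ‖x‖ ^ 3) := by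
    nlinarith [mul_nonneg (by linarith : 0 ≤ 1 + ‖x‖) (sq_nonneg (1 - ‖x‖))]
  calc _ ≤ ‖psF f s x‖ * (4 * (1 + ‖x‖ ^ 3)) := by gcongr
    _ = 4 * (‖x‖ ^ 0 * ‖psF f s x‖ + ‖x‖ ^ 3 * ‖psF f s x‖) := by ring
    _ ≤ _ := by gcongr

lemma ps_fderiv_slice {f : ℝ × ℝ × ℝ → ℝ} (hf : PSch f) (s : ℝ) (x v : ℂ) :
    fderiv ℝ (psF f s) x v = ((fderiv ℝ f (s, x.re, x.im) (psL v) : ℝ) : ℂ) := by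
  have hd : Differentiable ℝ f := hf.1.differentiable (by simp)
  have h1 : HasFDerivAt (fun y : ℂ => psL y + ((s, 0, 0) : ℝ × ℝ × ℝ)) psL x :=
    (psL.hasFDerivAt (x := x)).add_const _
  have h2 : HasFDerivAt f (fderiv ℝ f (s, x.re, x.im)) (psL x + ((s, 0, 0) : ℝ × ℝ × ℝ)) := by
    have e : psL x + ((s, 0, 0) : ℝ × ℝ × ℝ) = (s, x.re, x.im) := by simp [psL_apply]
    rw [e]; exact (hd _).hasFDerivAt
  have h3 := (ContinuousLinearMap.hasFDerivAt (𝕜 := ℝ) (x := f (psL x + ((s, 0, 0) : ℝ × ℝ × ℝ))) Complex.ofRealCLM).comp x (h2.comp x h1)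
  have h5 : psF f s = Complex.ofRealCLM ∘ f ∘ fun y : ℂ => psL y + ((s, 0, 0) : ℝ × ℝ × ℝ) := psF_eq f s
  rw [h5, h3.fderiv]; simp

lemma PSch.slice_dX1 {f : ℝ × ℝ × ℝ → ℝ} (hf : PSch f) {s : ℝ} (hs : 0 ≤ s) :
    hf.dX1.slice hs = ∂_{(1:ℂ)} (hf.slice hs) := by
  ext x
  rw [SchwartzMap.lineDerivOp_apply_eq_fderiv, slice_coe, slice_coe, ps_fderiv_slice hf]
  simp [psF, _root_.dX1, psL_apply]

lemma PSch.slice_dX2 {f : ℝ × ℝ × ℝ → ℝ} (hf : PSch f) {s : ℝ} (hs : 0 ≤ s) :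
    hf.dX2.slice hs = ∂_{Complex.I} (hf.slice hs) := by
  ext x
  rw [SchwartzMap.lineDerivOp_apply_eq_fderiv, slice_coe, slice_coe, ps_fderiv_slice hf]
  simp [psF, _root_.dX2, psL_apply]

lemma PSch.slice_heatOp {f : ℝ × ℝ × ℝ → ℝ} (hf : PSch f) {s : ℝ} (hs : 0 ≤ s) :
    hf.dS.slice hs = hf.heatOp.slice hs + (hf.dX1.dX1.slice hs + hf.dX2.dX2.slice hs) := by
  ext x
  simp only [_root_.add_apply, slice_coe]
  simp [psF, _root_.heatOp, lap]

lemma ps_fourier_dd (f : 𝓢(ℂ, ℂ)) (m ξ : ℂ) :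
    𝓕 (∂_{m} (∂_{m} f)) ξ = -(4 * Real.pi ^ 2 * (inner ℝ ξ m) ^ 2 : ℝ) * 𝓕 f ξ := by
  have ht : (fun x : ℂ => inner ℝ x m).HasTemperateGrowth := ((innerSL ℝ).flip m).hasTemperateGrowth
  rw [SchwartzMap.fourier_lineDerivOp_eq, _root_.smul_apply, SchwartzMap.smulLeftCLM_apply_apply ht,
    SchwartzMap.fourier_lineDerivOp_eq, _root_.smul_apply, SchwartzMap.smulLeftCLM_apply_apply ht]
  simp only [smul_eq_mul, Complex.real_smul]
  push_cast
  linear_combination (4 * Real.pi ^ 2 * (inner ℝ ξ m : ℝ) ^ 2 * 𝓕 f ξ : ℂ) * Complex.I_sq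

/-- Fourier transform of slices -/
def psH (f : ℝ × ℝ × ℝ → ℝ) (s : ℝ) (ξ : ℂ) : ℂ := 𝓕 (psF f s) ξ

lemma PSch.psH_eq {f : ℝ × ℝ × ℝ → ℝ} (hf : PSch f) {s : ℝ} (hs : 0 ≤ s) (ξ : ℂ) :
    psH f s ξ = 𝓕 (hf.slice hs) ξ := rfl

lemma PSch.psH_heatOp {f : ℝ × ℝ × ℝ → ℝ} (hf : PSch f) {s : ℝ} (hs : 0 ≤ s) (ξ : ℂ) :
    psH (_root_.heatOp f) s ξ = psH (_root_.dS f) s ξ + ((4 * Real.pi ^ 2 * ‖ξ‖ ^ 2 : ℝ) : ℂ) * psH f s ξ := by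
  rw [hf.heatOp.psH_eq hs, hf.dS.psH_eq hs, hf.psH_eq hs, slice_heatOp hf,
    FourierTransform.fourier_add, FourierTransform.fourier_add, slice_dX1 hf.dX1, slice_dX1 hf, slice_dX2 hf.dX2, slice_dX2 hf,
    _root_.add_apply, _root_.add_apply, ps_fourier_dd, ps_fourier_dd]
  have e : ‖ξ‖ ^ 2 = (inner ℝ ξ (1:ℂ)) ^ 2 + (inner ℝ ξ Complex.I) ^ 2 := by
    rw [← Complex.normSq_eq_norm_sq, Complex.normSq_apply]
    simp [Complex.inner]; ring
  rw [e]; push_cast; ring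

lemma psH_apply (f : ℝ × ℝ × ℝ → ℝ) (s : ℝ) (ξ : ℂ) :
    psH f s ξ = ∫ x : ℂ, (Real.fourierChar (-(inner ℝ x ξ)) : ℂ) * psF f s x := by
  rw [psH, Real.fourier_eq]
  rfl

lemma PSch.psH_meas {f : ℝ × ℝ × ℝ → ℝ} (hf : PSch f) :
    Measurable (fun p : ℝ × ℂ => psH f p.1 p.2) := by
  have hc : Continuous f := hf.1.continuous
  have e : (fun p : ℝ × ℂ => psH f p.1 p.2) = fun p : ℝ × ℂ =>
     ∫ x : ℂ, (Real.fourierChar (-(inner ℝ x p.2)) : ℂ) * psF f p.1 x := by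
    ext p; exact psH_apply _ _ _
  rw [e]
  have hm : StronglyMeasurable (fun q : (ℝ × ℂ) × ℂ => (Real.fourierChar (-(inner ℝ q.2 q.1.2)) : ℂ) * psF f q.1.1 q.2) := by
    apply Continuous.stronglyMeasurable
    unfold psF
    fun_prop
  exact hm.integral_prod_right.measurable

lemma PSch.integrable_slice {f : ℝ × ℝ × ℝ → ℝ} (hf : PSch f) {s : ℝ} (hs : 0 ≤ s) (ξ : ℂ) :
    Integrable (fun x : ℂ => (Real.fourierChar (-(inner ℝ x ξ)) : ℂ) * psF f s x) := by
  have h := (hf.slice hs).integrable (μ := volume)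
  rw [slice_coe] at h
  refine h.norm.mono' ?_ ?_
  · apply Continuous.aestronglyMeasurable
    have hc : Continuous f := hf.1.continuous
    unfold psF
    fun_prop
  · exact Filter.Eventually.of_forall fun x => by rw [norm_mul, Circle.norm_coe, one_mul]

lemma PSch.duhamel {f : ℝ × ℝ × ℝ → ℝ} (hf : PSch f) {s : ℝ} (hs : 0 ≤ s) (ξ : ℂ) :
    (Real.exp (4 * Real.pi ^ 2 * ‖ξ‖ ^ 2 * s) : ℂ) * psH f s ξ - psH f 0 ξ =
      ∫ r in Set.Ioc 0 s, (Real.exp (4 * Real.pi ^ 2 * ‖ξ‖ ^ 2 * r) : ℂ) * psH (_root_.heatOp f) r ξ := by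
  set l : ℝ := 4 * Real.pi ^ 2 * ‖ξ‖ ^ 2 with hl
  set g : ℝ × ℝ × ℝ → ℝ := fun p => _root_.dS f p + l * f p with hgdef
  have hg : PSch g := hf.dS.lin hf l
  have hgc : Continuous g := hg.1.continuous
  have hfc : Continuous f := hf.1.continuous
  have hd : Differentiable ℝ f := hf.1.differentiable (by simp)
  have e1 : ∀ r ∈ Set.Ioc 0 s, (Real.exp (l * r) : ℂ) * psH (_root_.heatOp f) r ξ =
      ∫ x : ℂ, (Real.fourierChar (-(inner ℝ x ξ)) : ℂ) * ((Real.exp (l * r) : ℂ) * psF g r x) := by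
    intro r hr
    rw [hf.psH_heatOp hr.1.le, ← hl, psH_apply, psH_apply, ← integral_const_mul, ← integral_add
      (hf.dS.integrable_slice hr.1.le ξ) ((hf.integrable_slice hr.1.le ξ).const_mul _), ← integral_const_mul]
    congr 1; ext x
    simp only [psF, hgdef]
    push_cast
    ring
  rw [setIntegral_congr_fun measurableSet_Ioc e1, integral_integral_swap]
  · have e2 : ∀ x : ℂ, ∫ r in Set.Ioc 0 s, (Real.fourierChar (-(inner ℝ x ξ)) : ℂ) * ((Real.exp (l * r) : ℂ) * psF g r x)
        = (Real.exp (l * s) : ℂ) * ((Real.fourierChar (-(inner ℝ x ξ)) : ℂ) * psF f s x)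
          - (Real.fourierChar (-(inner ℝ x ξ)) : ℂ) * psF f 0 x := by
      intro x
      rw [integral_const_mul]
      have e3 : ∫ r in Set.Ioc 0 s, (Real.exp (l * r) : ℂ) * psF g r x =
          ((∫ r in (0:ℝ)..s, Real.exp (l * r) * g (r, x.re, x.im) : ℝ) : ℂ) := by
        rw [intervalIntegral.integral_of_le hs, ← integral_complex_ofReal]
        congr 1; ext r; simp [psF]
      rw [e3, intervalIntegral.integral_eq_sub_of_hasDerivAt (f := fun r => Real.exp (l * r) * f (r, x.re, x.im))]
      · simp [psF]; ring
      · intro r _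
        have d1 : HasDerivAt (fun r => Real.exp (l * r)) (Real.exp (l * r) * (l * 1)) r :=
          ((hasDerivAt_id r).const_mul l).exp
        have d2 : HasDerivAt (fun r : ℝ => ((r, x.re, x.im) : ℝ × ℝ × ℝ)) (1, 0, 0) r :=
          (hasDerivAt_id r).prodMk ((hasDerivAt_const r _).prodMk (hasDerivAt_const r _))
        have d3 : HasDerivAt (fun r : ℝ => f (r, x.re, x.im)) (fderiv ℝ f (r, x.re, x.im) (1, 0, 0)) r :=
          (hd (r, x.re, x.im)).hasFDerivAt.comp_hasDerivAt r d2
        refine (d1.mul d3).congr_deriv ?_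
        change _ = Real.exp (l * r) * (fderiv ℝ f (r, x.re, x.im) (1, 0, 0) + l * f (r, x.re, x.im))
        ring
      · apply Continuous.intervalIntegrable
        fun_prop
    simp_rw [e2]
    rw [integral_sub ((hf.integrable_slice hs ξ).const_mul _) (hf.integrable_slice le_rfl ξ),
      integral_const_mul, ← psH_apply, ← psH_apply]
  · obtain ⟨C, hC⟩ := hg.bound
    have hl0 : 0 ≤ l := by positivity
    have hI : Integrable (fun x : ℂ => (1 + ‖x‖) ^ (-3:ℝ)) :=
      integrable_one_add_norm (by rw [Complex.finrank_real_complex]; norm_num)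
    have hc : Integrable (fun _ : ℝ => Real.exp (l * s) * C) (volume.restrict (Set.Ioc 0 s)) := by
      exact integrable_const _
    refine (hc.mul_prod hI).mono' ?_ ?_
    · apply Continuous.aestronglyMeasurable
      unfold psF Function.uncurry
      fun_prop
    · have hmem : ∀ᵐ p ∂((volume.restrict (Set.Ioc 0 s)).prod (volume : Measure ℂ)), p.1 ∈ Set.Ioc 0 s :=
        Measure.quasiMeasurePreserving_fst.ae (ae_restrict_mem measurableSet_Ioc)
      filter_upwards [hmem] with p hp
      have h1 := hC p.1 hp.1.le p.2
      simp only [Function.uncurry]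
      rw [norm_mul, norm_mul, Circle.norm_coe, one_mul, Complex.norm_real, Real.norm_eq_abs,
        abs_of_pos (Real.exp_pos _)]
      rw [mul_assoc (Real.exp (l * s)) C]
      refine mul_le_mul (Real.exp_le_exp.mpr (mul_le_mul_of_nonneg_left hp.2 hl0)) h1 (norm_nonneg _) (Real.exp_pos _).le

lemma PSch.duhamel_le {f : ℝ × ℝ × ℝ → ℝ} (hf : PSch f) {s : ℝ} (hs : 0 < s) (ξ : ℂ) :
    ‖psH f s ξ‖ₑ ≤ psE s ξ * ‖psH f 0 ξ‖ₑ
      + ∫⁻ r in Set.Ioc 0 s, psE (s - r) ξ * ‖psH (_root_.heatOp f) r ξ‖ₑ := by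
  have h := hf.duhamel hs.le ξ
  set l : ℝ := 4 * Real.pi ^ 2 * ‖ξ‖ ^ 2 with hl
  have he : (Real.exp (-(l * s)) : ℂ) * (Real.exp (l * s) : ℂ) = 1 := by
    rw [← Complex.ofReal_mul, ← Real.exp_add]; simp
  have hE : ∀ t, ‖(Real.exp (l * t) : ℂ)‖ₑ = ENNReal.ofReal (Real.exp (l * t)) := by
    intro t
    rw [← ofReal_norm, Complex.norm_real, Real.norm_eq_abs, abs_of_pos (Real.exp_pos _)]
  have hpe : ∀ t, psE t ξ = ENNReal.ofReal (Real.exp (l * (-t))) := by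
    intro t; rw [psE]; congr 2; rw [hl]; ring
  have h2 : psH f s ξ = (Real.exp (l * (-s)) : ℂ) * (psH f 0 ξ +
      ∫ r in Set.Ioc 0 s, (Real.exp (l * r) : ℂ) * psH (_root_.heatOp f) r ξ) := by
    rw [← h, mul_neg]; linear_combination (-psH f s ξ) * he
  rw [h2, enorm_mul, hE, ← hpe]
  calc _ ≤ psE s ξ * (‖psH f 0 ξ‖ₑ + ∫⁻ r in Set.Ioc 0 s, ‖(Real.exp (l * r) : ℂ) * psH (_root_.heatOp f) r ξ‖ₑ) := by
        gcongr
        refine (enorm_add_le _ _).trans ?_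
        gcongr
        exact enorm_integral_le_lintegral_enorm _
    _ = _ := by
        rw [mul_add, ← lintegral_const_mul']
        · congr 2; ext r
          rw [enorm_mul, hE, ← mul_assoc, hpe, hpe, ← ENNReal.ofReal_mul (Real.exp_pos _).le, ← Real.exp_add]
          congr 4; ring
        · rw [hpe]; exact ENNReal.ofReal_ne_top

lemma PSch.plancherel {f : ℝ × ℝ × ℝ → ℝ} (hf : PSch f) {s : ℝ} (hs : 0 ≤ s) :
    (∫⁻ ξ, ‖psH f s ξ‖ₑ ^ 2) ^ (1/2:ℝ) = ENNReal.ofReal (Real.sqrt (∫ x : ℝ × ℝ, (f (s, x)) ^ 2)) := by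
  have h := SchwartzMap.integral_norm_sq_fourier (hf.slice hs)
  have h1 : ∫ x : ℂ, ‖hf.slice hs x‖ ^ 2 = ∫ x : ℝ × ℝ, (f (s, x)) ^ 2 := by
    rw [← Complex.volume_preserving_equiv_real_prod.integral_comp
      Complex.measurableEquivRealProd.measurableEmbedding]
    congr 1; ext x
    rw [slice_coe]; simp [psF]
  have hint : Integrable (fun ξ : ℂ => ‖𝓕 (hf.slice hs) ξ‖ ^ 2) := by
    have := ((𝓕 (hf.slice hs)).memLp 2 volume)
    exact this.integrable_norm_pow (by norm_num)
  rw [← h1, ← h, Real.sqrt_eq_rpow, ← ENNReal.ofReal_rpow_of_nonneg (by positivity) (by norm_num),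
    ofReal_integral_eq_lintegral_ofReal hint (Filter.Eventually.of_forall fun ξ => by positivity)]
  congr 2; ext ξ
  rw [hf.psH_eq hs, ENNReal.ofReal_pow (norm_nonneg _), ofReal_norm]

lemma PSch.sup_le {f : ℝ × ℝ × ℝ → ℝ} (hf : PSch f) {s : ℝ} (hs : 0 ≤ s) :
    ENNReal.ofReal ((⨆ x : ℝ × ℝ, |f (s, x)|) ^ 2) ≤ (∫⁻ ξ, ‖psH f s ξ‖ₑ) ^ 2 := by
  have hint : Integrable (fun ξ : ℂ => 𝓕 (hf.slice hs) ξ) := (𝓕 (hf.slice hs)).integrable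
  have hb : ∀ x : ℝ × ℝ, |f (s, x)| ≤ ∫ ξ, ‖𝓕 (hf.slice hs) ξ‖ := by
    intro x
    have h1 : hf.slice hs (x.1 + x.2 * Complex.I) = (f (s, x) : ℂ) := by
      rw [slice_coe]; simp [psF]
    have h2 : hf.slice hs (x.1 + x.2 * Complex.I) = 𝓕⁻ (𝓕 (hf.slice hs)) (x.1 + x.2 * Complex.I) := by
      rw [FourierTransform.fourierInv_fourier_eq]
    rw [SchwartzMap.fourierInv_coe, Real.fourierInv_eq, h1] at h2
    have h3 : |f (s, x)| = ‖(f (s, x) : ℂ)‖ := by simp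
    rw [h3, h2]
    refine (norm_integral_le_integral_norm _).trans (le_of_eq ?_)
    congr 1; ext ξ
    simp
  have h4 : (⨆ x : ℝ × ℝ, |f (s, x)|) ≤ ∫ ξ, ‖𝓕 (hf.slice hs) ξ‖ := ciSup_le hb
  have h5 : 0 ≤ (⨆ x : ℝ × ℝ, |f (s, x)|) := Real.iSup_nonneg fun x => abs_nonneg _
  rw [ENNReal.ofReal_pow h5]
  gcongr
  refine (ENNReal.ofReal_le_ofReal h4).trans (le_of_eq ?_)
  rw [ofReal_integral_norm_eq_lintegral_enorm hint]
  rfl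

/-- Parabolic Strichartz estimate: for `ψ : [0,∞) × ℝ² → ℝ` smooth with all derivatives
uniformly Schwartz in space,
`(∫₀^∞ ‖ψ(s)‖_{L^∞_x}² ds)^{1/2} ≲ ‖ψ(0)‖_{L²_x} + ∫₀^∞ ‖(∂ₛψ − Δψ)(s)‖_{L²_x} ds`,
with an absolute constant. -/
theorem parabolic_strichartz :
    ∃ C > (0 : ℝ), ∀ ψ : ℝ × ℝ × ℝ → ℝ,
      ContDiff ℝ (⊤ : ℕ∞) ψ →
      (∀ n N : ℕ, ∃ B : ℝ, ∀ p : ℝ × ℝ × ℝ, 0 ≤ p.1 →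
        ‖p.2‖ ^ N * ‖iteratedFDeriv ℝ n ψ p‖ ≤ B) →
      (∫⁻ s in Set.Ioi (0 : ℝ),
          ENNReal.ofReal ((⨆ x : ℝ × ℝ, |ψ (s, x)|) ^ 2)) ^ ((1 : ℝ) / 2)
        ≤ ENNReal.ofReal C *
          (ENNReal.ofReal (Real.sqrt (∫ x : ℝ × ℝ, (ψ (0, x)) ^ 2))
            + ∫⁻ s in Set.Ioi (0 : ℝ),
                ENNReal.ofReal (Real.sqrt (∫ x : ℝ × ℝ, (heatOp ψ (s, x)) ^ 2))) := by
  refine ⟨1, one_pos, fun ψ h1 h2 => ?_⟩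
  have hf : PSch ψ := ⟨h1, h2⟩
  rw [ENNReal.ofReal_one, one_mul]
  have hG : Measurable (Function.uncurry fun r ξ => ‖psH (heatOp ψ) r ξ‖ₑ) := hf.heatOp.psH_meas.enorm
  have hg : Measurable (fun ξ => ‖psH ψ 0 ξ‖ₑ) :=
    (hf.psH_meas.comp (measurable_prodMk_left (x := (0:ℝ)))).enorm
  have key := ps_duh (a := fun s ξ => ‖psH ψ s ξ‖ₑ) hg hG (fun s hs ξ => hf.duhamel_le hs ξ)
  calc _ ≤ (∫⁻ s in Set.Ioi (0:ℝ), (∫⁻ ξ, ‖psH ψ s ξ‖ₑ) ^ 2) ^ (1/2:ℝ) := by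
        apply ENNReal.rpow_le_rpow _ (by norm_num)
        exact setLIntegral_mono' measurableSet_Ioi fun s hs => hf.sup_le (le_of_lt hs)
    _ ≤ _ := key
    _ = _ := by
        rw [hf.plancherel le_rfl]
        congr 1
        exact setLIntegral_congr_fun measurableSet_Ioi fun s hs => hf.heatOp.plancherel (le_of_lt hs)

end
end

section
/- (Gronwall-type inequality from s = +∞) Let E > 0 and 0 ≤ θ < 1, and let c be a frequency envelope of energy at most E. Let f, g : (0,∞) → [0,∞) be locally integrable functions such that f(s) → 0 as s → ∞, g satisfies g(s′) ≤ max((s′/s)^{δ₀},(s/s′)^{δ₀}) g(s) for all s, s′ > 0, and f(s) ≤ g(s) + ∫_s^∞ f(s′) c(s′) ((s′−s)/s′)^{−θ} (s′/s)^{−3δ₀} ds′/s′ for all s > 0. Then f(s) ≤ C g(s) for all s > 0, where C depends only on E, θ, and δ₀. -/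
open MeasureTheory

/-- A frequency envelope of energy at most `E`. -/
def IsFreqEnvelopeLE (δ₀ E : ℝ) (c : ℝ → ℝ) : Prop :=
  (∀ s : ℝ, 0 < s → 0 ≤ c s) ∧
  IntegrableOn (fun s => (c s) ^ 2 / s) (Set.Ioi 0) volume ∧
  (∫ s in Set.Ioi (0 : ℝ), (c s) ^ 2 / s) ≤ E ∧
  (∀ s : ℝ, 0 < s → ∀ s' : ℝ, 0 < s' →
    c s' ≤ max ((s' / s) ^ δ₀) ((s / s') ^ δ₀) * c s)


lemma env_cont (δ : ℝ) (e : ℝ → ℝ)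
    (h : ∀ s : ℝ, 0 < s → ∀ s' : ℝ, 0 < s' →
      e s' ≤ max ((s' / s) ^ δ) ((s / s') ^ δ) * e s) : ContinuousOn e (Set.Ioi 0) := by
  intro s hs
  have hs' : (0:ℝ) < s := hs
  have hM : Filter.Tendsto (fun s' : ℝ => max ((s' / s) ^ δ) ((s / s') ^ δ))
      (nhdsWithin s (Set.Ioi 0)) (nhds 1) := by
    have : ContinuousAt (fun s' : ℝ => max ((s' / s) ^ δ) ((s / s') ^ δ)) s := by
      refine ContinuousAt.sup ?_ ?_
      · apply ContinuousAt.rpow_const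
        · fun_prop
        · left; positivity
      · apply ContinuousAt.rpow_const
        · exact continuousAt_const.div continuousAt_id hs'.ne'
        · left; positivity
    have h2 := this.tendsto
    simp only [div_self hs'.ne', Real.one_rpow, max_self] at h2
    exact h2.mono_left nhdsWithin_le_nhds
  have hu : Filter.Tendsto (fun s' : ℝ => max ((s' / s) ^ δ) ((s / s') ^ δ) * e s)
      (nhdsWithin s (Set.Ioi 0)) (nhds (e s)) := by
    simpa using hM.mul_const (e s)
  have hl : Filter.Tendsto (fun s' : ℝ => e s / max ((s' / s) ^ δ) ((s / s') ^ δ))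
      (nhdsWithin s (Set.Ioi 0)) (nhds (e s)) := by
    have := (tendsto_const_nhds (x := e s)).div hM one_ne_zero
    rw [div_one] at this
    exact this
  refine tendsto_of_tendsto_of_tendsto_of_le_of_le' hl hu ?_ ?_
  · filter_upwards [self_mem_nhdsWithin] with x hx
    have hx' : (0:ℝ) < x := hx
    rw [div_le_iff₀ (lt_max_of_lt_left (by positivity)), mul_comm, max_comm]
    exact h x hx' s hs'
  · filter_upwards [self_mem_nhdsWithin] with x hx
    exact h s hs' x hx

lemma env_bdd (δ E : ℝ) (hδ : 0 < δ) (hδ' : δ ≤ 1) (c : ℝ → ℝ)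
    (h0 : ∀ s : ℝ, 0 < s → 0 ≤ c s)
    (hi : IntegrableOn (fun s => (c s) ^ 2 / s) (Set.Ioi 0) volume)
    (hE : (∫ s in Set.Ioi (0 : ℝ), (c s) ^ 2 / s) ≤ E)
    (h : ∀ s : ℝ, 0 < s → ∀ s' : ℝ, 0 < s' →
      c s' ≤ max ((s' / s) ^ δ) ((s / s') ^ δ) * c s) (s : ℝ) (hs : 0 < s) :
    c s ^ 2 ≤ 8 * E := by
  have hsub : Set.Ioc s (2*s) ⊆ Set.Ioi 0 := fun x hx => hs.trans hx.1
  have h1 : ∫ x in Set.Ioc s (2*s), (c x)^2 / x ≤ E := by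
    refine le_trans (setIntegral_mono_set hi ?_ hsub.eventuallyLE) hE
    filter_upwards [self_mem_ae_restrict measurableSet_Ioi] with x hx
    have : (0:ℝ) < x := hx
    show (0:ℝ) ≤ _
    positivity
  have h2 : ∫ x in Set.Ioc s (2*s), (c s)^2 / (8 * s) ≤ ∫ x in Set.Ioc s (2*s), (c x)^2 / x := by
    refine setIntegral_mono_on ?_ (hi.mono_set hsub) measurableSet_Ioc ?_
    · apply integrableOn_const (by simp)
    · intro x hx
      have hx0 : 0 < x := hs.trans hx.1
      have hc : c s ≤ 2 * c x := by
        refine (h x hx0 s hs).trans (mul_le_mul_of_nonneg_right ?_ (h0 x hx0))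
        apply max_le
        · refine (Real.rpow_le_one (by positivity) ?_ hδ.le).trans (by norm_num)
          rw [div_le_one hx0]; exact hx.1.le
        · have h3 : 1 ≤ x / s := by rw [one_le_div hs]; exact hx.1.le
          refine (Real.rpow_le_rpow_of_exponent_le h3 hδ').trans ?_
          rw [Real.rpow_one, div_le_iff₀ hs]; exact hx.2
      have hc2 : c s ^ 2 ≤ 4 * c x ^ 2 := by nlinarith [h0 s hs, h0 x hx0]
      rw [div_le_div_iff₀ (by positivity) hx0]
      have := hx.2
      nlinarith [mul_le_mul hc2 hx.2 hx0.le (by positivity)]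
  rw [setIntegral_const] at h2
  simp only [Measure.real, Real.volume_Ioc, smul_eq_mul] at h2
  rw [ENNReal.toReal_ofReal (by linarith)] at h2
  have h3 : (2 * s - s) * (c s ^ 2 / (8 * s)) = c s ^ 2 / 8 := by field_simp; ring
  rw [h3] at h2
  linarith

lemma young_nat (n : ℕ) (η c r : ℝ) (hη : 0 < η) (hc : 0 ≤ c) (hr : 0 ≤ r) :
    c * r ^ n ≤ η * r ^ (n+1) + (η⁻¹) ^ n * c ^ (n+1) := by
  rcases le_total c (η * r) with h | h
  · have : c * r ^ n ≤ η * r * r ^ n := by gcongr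
    have h2 : 0 ≤ (η⁻¹) ^ n * c ^ (n+1) := by positivity
    calc _ ≤ _ := this
      _ = η * r ^ (n+1) := by ring
      _ ≤ _ := by linarith
  · have h1 : r ≤ η⁻¹ * c := by rw [inv_mul_eq_div, le_div_iff₀ hη]; linarith
    have : c * r ^ n ≤ c * (η⁻¹ * c) ^ n := by gcongr
    have h2 : 0 ≤ η * r ^ (n+1) := by positivity
    calc _ ≤ _ := this
      _ = (η⁻¹) ^ n * c ^ (n+1) := by rw [mul_pow]; ring
      _ ≤ _ := by linarith

lemma kernel_int (s a b : ℝ) (hs : 0 < s) (ha0 : 0 ≤ a) (ha : a < 1) (hb0 : 0 < b) (hb : b ≤ 1) :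
    ∫⁻ x in Set.Ioi s, ENNReal.ofReal (((x - s) / x) ^ (-a) * (x / s) ^ (-b) / x)
      ≤ ENNReal.ofReal (1 / ((1 - a) * b)) := by
  set Φ : ℝ → ℝ := fun x => (1 / ((1 - a) * b)) * (1 - (x / s) ^ (-b)) ^ (1 - a) with hΦ
  set Φ' : ℝ → ℝ := fun x => (1 - (x / s) ^ (-b)) ^ (-a) * (x / s) ^ (-b) / x with hΦ'
  have h1a : 0 < 1 - a := by linarith
  have hlt : ∀ x ∈ Set.Ioi s, (x/s)^(-b) < 1 := by
    intro x hx
    exact Real.rpow_lt_one_of_one_lt_of_neg (by rw [one_lt_div hs]; exact hx) (by linarith)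
  have hder : ∀ x ∈ Set.Ioi s, HasDerivAt Φ (Φ' x) x := by
    intro x hx
    have hx0 : 0 < x := hs.trans hx
    have hv : 0 < x / s := by positivity
    have d1 : HasDerivAt (fun x : ℝ => x / s) (1 / s) x := (hasDerivAt_id x).div_const s
    have d2 := d1.rpow_const (p := -b) (Or.inl hv.ne')
    have d3 := (d2.const_sub 1).rpow_const (p := 1 - a) (Or.inl (by have := hlt x hx; linarith))
    have d4 := d3.const_mul (1 / ((1 - a) * b))
    refine d4.congr_deriv ?_
    simp only [hΦ']
    rw [show (1 - a - 1) = -a by ring, Real.rpow_sub_one hv.ne']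
    field_simp
  have hcont : ContinuousWithinAt Φ (Set.Ici s) s := by
    apply ContinuousAt.continuousWithinAt
    apply ContinuousAt.mul continuousAt_const
    apply ContinuousAt.rpow_const
    · apply ContinuousAt.sub continuousAt_const
      apply ContinuousAt.rpow_const (by fun_prop)
      left; positivity
    · right; exact h1a.le
  have hpos : ∀ x ∈ Set.Ioi s, 0 ≤ Φ' x := by
    intro x hx
    have hx0 : 0 < x := hs.trans hx
    have := hlt x hx
    have h2 : 0 ≤ 1 - (x / s) ^ (-b) := by linarith
    simp only [hΦ']
    positivity
  have hlim : Filter.Tendsto Φ Filter.atTop (nhds (1 / ((1 - a) * b))) := by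
    have t1 : Filter.Tendsto (fun x : ℝ => (x / s) ^ (-b)) Filter.atTop (nhds 0) :=
      (tendsto_rpow_neg_atTop hb0).comp (Filter.tendsto_id.atTop_div_const hs)
    have t2 : Filter.Tendsto (fun x : ℝ => (1 - (x / s) ^ (-b)) ^ (1 - a)) Filter.atTop
        (nhds ((1 - 0) ^ (1 - a))) := (tendsto_const_nhds.sub t1).rpow_const (Or.inl (by norm_num))
    have t3 := t2.const_mul (1 / ((1 - a) * b))
    rw [sub_zero, Real.one_rpow, mul_one] at t3
    exact t3
  have hint := integrableOn_Ioi_deriv_of_nonneg hcont hder hpos hlim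
  have hval := integral_Ioi_of_hasDerivAt_of_nonneg hcont hder hpos hlim
  have hΦs : Φ s = 0 := by
    simp only [hΦ, div_self hs.ne', Real.one_rpow, sub_self, Real.zero_rpow h1a.ne', mul_zero]
  rw [hΦs, sub_zero] at hval
  rw [← hval, ofReal_integral_eq_lintegral_ofReal hint
    ((ae_restrict_iff' measurableSet_Ioi).2 (Filter.Eventually.of_forall hpos))]
  refine setLIntegral_mono' measurableSet_Ioi ?_
  intro x hx
  have hx0 : 0 < x := hs.trans hx
  apply ENNReal.ofReal_le_ofReal
  simp only [hΦ']
  have hA : 1 - (x / s) ^ (-b) ≤ (x - s) / x := by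
    have : (x / s) ^ (-1 : ℝ) ≤ (x / s) ^ (-b) :=
      Real.rpow_le_rpow_of_exponent_le (by rw [one_le_div hs]; exact (le_of_lt hx)) (by linarith)
    rw [Real.rpow_neg_one, inv_div] at this
    have e : (x - s) / x = 1 - s / x := by field_simp
    linarith
  have hB : ((x - s) / x) ^ (-a) ≤ (1 - (x / s) ^ (-b)) ^ (-a) :=
    Real.rpow_le_rpow_of_nonpos (by have := hlt x hx; linarith) hA (by linarith)
  have : 0 < x / s := by positivity
  gcongr

lemma W_int (u : ℝ → ℝ) (A : ℝ) (hA : 0 < A) (hu : ContinuousOn u (Set.Ioi 0))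
    (hu0 : ∀ s : ℝ, 0 < s → 0 ≤ u s) (hi : IntegrableOn u (Set.Ioi 0) volume) :
    ∃ W : ℝ → ℝ, ContinuousOn W (Set.Ioi 0) ∧
      (∀ s, 0 < s → 1 ≤ W s ∧ W s ≤ Real.exp (A * ∫ x in Set.Ioi 0, u x)) ∧
      (∀ s s', 0 < s → s ≤ s' → W s' ≤ W s) ∧
      (∀ s, 0 < s → ∫⁻ x in Set.Ioi s, ENNReal.ofReal (u x * W x) ≤ ENNReal.ofReal (W s / A)) := by
  set F : ℝ → ℝ := fun s => ∫ x in Set.Ioi s, u x with hF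
  have hsub : ∀ s : ℝ, 0 ≤ s → Set.Ioi s ⊆ Set.Ioi 0 := fun s hs => Set.Ioi_subset_Ioi hs
  have hanti : ∀ s s' : ℝ, 0 ≤ s → s ≤ s' → F s' ≤ F s := by
    intro s s' hs hss
    refine setIntegral_mono_set (hi.mono_set (hsub s hs)) ?_ (Set.Ioi_subset_Ioi hss).eventuallyLE
    filter_upwards [self_mem_ae_restrict measurableSet_Ioi] with x hx
    exact hu0 x (hsub s hs hx)
  have hF0 : ∀ s : ℝ, 0 ≤ s → 0 ≤ F s := fun s hs =>
    setIntegral_nonneg measurableSet_Ioi fun x hx => hu0 x (hsub s hs hx)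
  have hFd : ∀ s : ℝ, 0 < s → HasDerivAt F (-u s) s := by
    intro s hs
    have e : ∀ x ∈ Set.Ioi (0:ℝ), F x = F 0 - ∫ y in (0:ℝ)..x, u y := by
      intro x hx
      have := intervalIntegral.integral_interval_add_Ioi (a := 0) (b := x) (f := u) (μ := volume)
        hi (hi.mono_set (hsub x (le_of_lt hx)))
      simp only [hF]; linarith
    have d : HasDerivAt (fun x => F 0 - ∫ y in (0:ℝ)..x, u y) (-u s) s := by
      apply HasDerivAt.const_sub
      apply intervalIntegral.integral_hasDerivAt_right
      · rw [intervalIntegrable_iff_integrableOn_Ioc_of_le hs.le]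
        exact hi.mono_set Set.Ioc_subset_Ioi_self
      · exact hu.stronglyMeasurableAtFilter isOpen_Ioi s hs
      · exact hu.continuousAt (Ioi_mem_nhds hs)
    refine d.congr_of_eventuallyEq ?_
    filter_upwards [Ioi_mem_nhds hs] with x hx using e x hx
  have hWd : ∀ s : ℝ, 0 < s → HasDerivAt (fun x => -(Real.exp (A * F x) / A)) 
      (u s * Real.exp (A * F s)) s := by
    intro s hs
    have := (((hFd s hs).const_mul A).exp.div_const A).neg
    refine this.congr_deriv ?_
    field_simp
  refine ⟨fun x => Real.exp (A * F x), ?_, ?_, ?_, ?_⟩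
  · intro s hs
    exact ((hFd s hs).const_mul A).exp.continuousAt.continuousWithinAt
  · intro s hs
    refine ⟨Real.one_le_exp (mul_nonneg hA.le (hF0 s hs.le)), ?_⟩
    rw [Real.exp_le_exp]
    exact mul_le_mul_of_nonneg_left (hanti 0 s le_rfl hs.le) hA.le
  · intro s s' hs hss
    dsimp only
    rw [Real.exp_le_exp]
    exact mul_le_mul_of_nonneg_left (hanti s s' hs.le hss) hA.le
  · intro s hs
    have hcont : ContinuousWithinAt (fun x => -(Real.exp (A * F x) / A)) (Set.Ici s) s :=
      (hWd s hs).continuousAt.continuousWithinAt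
    have hder : ∀ x ∈ Set.Ioi s, HasDerivAt (fun x => -(Real.exp (A * F x) / A)) 
      (u x * Real.exp (A * F x)) x := fun x hx => hWd x (hs.trans hx)
    have hpos : ∀ x ∈ Set.Ioi s, 0 ≤ u x * Real.exp (A * F x) := fun x hx =>
      mul_nonneg (hu0 x (hs.trans hx)) (Real.exp_pos _).le
    have hint : IntegrableOn (fun x => u x * Real.exp (A * F x)) (Set.Ioi s) := by
      refine Integrable.mul_bdd (c := Real.exp (A * F 0)) (hi.mono_set (hsub s hs.le)) ?_ ?_
      · apply ContinuousOn.aestronglyMeasurable _ measurableSet_Ioi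
        intro x hx
        exact ((hFd x (hs.trans hx)).const_mul A).exp.continuousAt.continuousWithinAt
      · filter_upwards [self_mem_ae_restrict measurableSet_Ioi] with x hx
        rw [Real.norm_eq_abs, Real.abs_exp, Real.exp_le_exp]
        exact mul_le_mul_of_nonneg_left (hanti 0 x le_rfl (hs.trans hx).le) hA.le
    rw [← ofReal_integral_eq_lintegral_ofReal hint
      ((ae_restrict_iff' measurableSet_Ioi).2 (Filter.Eventually.of_forall hpos))]
    apply ENNReal.ofReal_le_ofReal
    refine le_of_tendsto (intervalIntegral_tendsto_integral_Ioi s hint Filter.tendsto_id) ?_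
    filter_upwards [Filter.eventually_ge_atTop s] with t ht
    simp only [id]
    rw [intervalIntegral.integral_eq_sub_of_hasDerivAt
      (f := fun x => -(Real.exp (A * F x) / A))]
    · have : 0 < Real.exp (A * F t) / A := by positivity
      linarith
    · intro x hx
      rw [Set.uIcc_of_le ht] at hx
      exact hWd x (hs.trans_le hx.1)
    · rw [intervalIntegrable_iff_integrableOn_Ioc_of_le ht]
      exact hint.mono_set Set.Ioc_subset_Ioi_self

lemma contraction (δ θ a η A : ℝ) (n : ℕ) (hn : 0 < n) (hδ : 0 < δ) (hδ' : 2 * δ ≤ 1)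
    (hθ₀ : 0 ≤ θ) (ha : a = θ * ((n + 1) / n)) (ha1 : a < 1)
    (hη : η = (1 - a) * (2 * δ) / 4) (hA : A = 4 * (η⁻¹) ^ n)
    (c G W : ℝ → ℝ) (hc : ∀ s : ℝ, 0 < s → 0 ≤ c s)
    (hG : ∀ s : ℝ, 0 < s → 0 ≤ G s) (hW : ∀ s : ℝ, 0 < s → 0 ≤ W s)
    (hGG : ∀ s s' : ℝ, 0 < s → s ≤ s' → G s' ≤ (s' / s) ^ δ * G s)
    (hWW : ∀ s s' : ℝ, 0 < s → s ≤ s' → W s' ≤ W s)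
    (hWi : ∀ s, 0 < s → ∫⁻ x in Set.Ioi s, ENNReal.ofReal (c x ^ (n + 1) / x * W x)
      ≤ ENNReal.ofReal (W s / A)) (s : ℝ) (hs : 0 < s) :
    ∫⁻ x in Set.Ioi s, ENNReal.ofReal
      (2 * G x * W x * c x * ((x - s) / x) ^ (-θ) * (x / s) ^ (-(3 * δ)) / x)
      ≤ ENNReal.ofReal (G s * W s) := by
  have h1a : 0 < 1 - a := by linarith
  have hη0 : 0 < η := by rw [hη]; positivity
  have hA0 : 0 < A := by rw [hA]; positivity
  have ha0 : 0 ≤ a := by rw [ha]; positivity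
  have hGs := hG s hs
  have hWs := hW s hs
  have key : ∀ x ∈ Set.Ioi s, 
      2 * G x * W x * c x * ((x - s) / x) ^ (-θ) * (x / s) ^ (-(3 * δ)) / x
      ≤ (2 * G s * (η * W s)) * (((x - s) / x) ^ (-a) * (x / s) ^ (-(2 * δ)) / x)
        + (2 * G s * (η⁻¹) ^ n) * (c x ^ (n + 1) / x * W x) := by
    intro x hx
    have hsx : s < x := hx
    have hx0 : 0 < x := hs.trans hsx
    have hcx := hc x hx0
    have hWx := hW x hx0
    have hGx := hG x hx0
    have hv0 : 0 < x / s := by positivity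
    have hv1 : 1 ≤ x / s := by rw [one_le_div hs]; exact hsx.le
    have hy : 0 < (x - s) / x := div_pos (by linarith) hx0
    set y := (x - s) / x with hydef
    have hn' : (0:ℝ) < n := by exact_mod_cast hn
    have e1 : (y ^ (-θ / n)) ^ n = y ^ (-θ) := by
      rw [← Real.rpow_natCast, ← Real.rpow_mul hy.le]; congr 1; field_simp
    have e2 : (y ^ (-θ / n)) ^ (n + 1) = y ^ (-a) := by
      rw [← Real.rpow_natCast, ← Real.rpow_mul hy.le, ha]; congr 1; push_cast; field_simp
    have hY := young_nat n η (c x) (y ^ (-θ / n)) hη0 hcx (by positivity)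
    rw [e1, e2] at hY
    have hg1 : G x * (x / s) ^ (-(3 * δ)) ≤ G s * (x / s) ^ (-(2 * δ)) := by
      calc G x * (x / s) ^ (-(3 * δ)) ≤ ((x / s) ^ δ * G s) * (x / s) ^ (-(3 * δ)) := by
            gcongr; exact hGG s x hs hsx.le
        _ = G s * ((x / s) ^ δ * (x / s) ^ (-(3 * δ))) := by ring
        _ = _ := by rw [← Real.rpow_add hv0]; congr 2; ring
    have hw1 := hWW s x hs hsx.le
    have hv2 : (x / s) ^ (-(2 * δ)) ≤ 1 := Real.rpow_le_one_of_one_le_of_nonpos hv1 (by linarith)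
    have hp : 0 < (x / s) ^ (-(2 * δ)) := by positivity
    calc 2 * G x * W x * c x * y ^ (-θ) * (x / s) ^ (-(3 * δ)) / x
        = 2 * (G x * (x / s) ^ (-(3 * δ))) * W x * (c x * y ^ (-θ)) / x := by ring
      _ ≤ 2 * (G s * (x / s) ^ (-(2 * δ))) * W x *
          (η * y ^ (-a) + (η⁻¹) ^ n * c x ^ (n+1)) / x := by gcongr
      _ = 2 * G s * (η * W x) * (y ^ (-a) * (x / s) ^ (-(2 * δ)) / x)
        + 2 * G s * (x / s) ^ (-(2 * δ)) * (η⁻¹) ^ n * (c x ^ (n + 1) / x * W x) := by ring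
      _ ≤ 2 * G s * (η * W s) * (y ^ (-a) * (x / s) ^ (-(2 * δ)) / x)
        + 2 * G s * 1 * (η⁻¹) ^ n * (c x ^ (n + 1) / x * W x) := by gcongr
      _ = _ := by ring
  have hα : 0 ≤ 2 * G s * (η * W s) := by positivity
  have hβ : 0 ≤ 2 * G s * (η⁻¹) ^ n := by positivity
  calc _ ≤ ∫⁻ x in Set.Ioi s,
        (ENNReal.ofReal (2 * G s * (η * W s)) * ENNReal.ofReal
          (((x - s) / x) ^ (-a) * (x / s) ^ (-(2 * δ)) / x)
        + ENNReal.ofReal (2 * G s * (η⁻¹) ^ n) * ENNReal.ofReal (c x ^ (n + 1) / x * W x)) := by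
        refine setLIntegral_mono' measurableSet_Ioi fun x hx => ?_
        rw [← ENNReal.ofReal_mul hα, ← ENNReal.ofReal_mul hβ]
        exact (ENNReal.ofReal_le_ofReal (key x hx)).trans ENNReal.ofReal_add_le
    _ = ENNReal.ofReal (2 * G s * (η * W s)) * (∫⁻ x in Set.Ioi s, ENNReal.ofReal
          (((x - s) / x) ^ (-a) * (x / s) ^ (-(2 * δ)) / x))
        + ENNReal.ofReal (2 * G s * (η⁻¹) ^ n) *
          ∫⁻ x in Set.Ioi s, ENNReal.ofReal (c x ^ (n + 1) / x * W x) := by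
        rw [lintegral_add_left (by fun_prop), lintegral_const_mul' _ _ ENNReal.ofReal_ne_top,
          lintegral_const_mul' _ _ ENNReal.ofReal_ne_top]
    _ ≤ ENNReal.ofReal (2 * G s * (η * W s)) * ENNReal.ofReal (1 / ((1 - a) * (2 * δ)))
        + ENNReal.ofReal (2 * G s * (η⁻¹) ^ n) * ENNReal.ofReal (W s / A) := by
        gcongr
        · exact kernel_int s a (2 * δ) hs ha0 ha1 (by linarith) hδ'
        · exact hWi s hs
    _ = ENNReal.ofReal (G s * W s) := by
        rw [← ENNReal.ofReal_mul hα, ← ENNReal.ofReal_mul hβ, ← ENNReal.ofReal_add (by positivity)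
          (by positivity)]
        congr 1
        have i1 : 2 * G s * (η * W s) * (1 / ((1 - a) * (2 * δ))) = G s * W s / 2 := by
          rw [hη]; field_simp; ring
        have i2 : 2 * G s * (η⁻¹) ^ n * (W s / A) = G s * W s / 2 := by
          rw [hA]; field_simp; ring
        rw [i1, i2]; ring

lemma exists_lam (D θ : ℝ) (hD : 0 ≤ D) (hθ₁ : θ < 1) : ∃ l : ℝ, 0 < l ∧
    ∫⁻ r in Set.Ioi (0:ℝ), ENNReal.ofReal (D * (r ^ (-θ) * Real.exp (-(l * r)))) ≤ 1 / 2 := by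
  have h1 : 0 < 1 - θ := by linarith
  have t : Filter.Tendsto (fun l : ℝ => D * ((1 / l) ^ (1 - θ) * Real.Gamma (1 - θ)))
      Filter.atTop (nhds 0) := by
    have := ((tendsto_rpow_neg_atTop h1).mul_const (Real.Gamma (1 - θ))).const_mul D
    rw [zero_mul, mul_zero] at this
    refine this.congr' ?_
    filter_upwards [Filter.eventually_gt_atTop 0] with l hl
    rw [one_div, Real.inv_rpow hl.le, Real.rpow_neg hl.le]
  obtain ⟨l, hl, hl0⟩ := ((t.eventually (gt_mem_nhds (show (0:ℝ) < 1 / 2 by norm_num))).and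
    (Filter.eventually_gt_atTop 0)).exists
  refine ⟨l, hl0, ?_⟩
  have key := Real.integral_rpow_mul_exp_neg_mul_Ioi h1 hl0
  rw [show 1 - θ - 1 = -θ by ring] at key
  have hG := Real.Gamma_pos_of_pos h1
  have hint : IntegrableOn (fun x ↦ x ^ (-θ) * Real.exp (-(l * x))) (Set.Ioi 0) :=
    .of_integral_ne_zero (by rw [key]; positivity)
  rw [← ofReal_integral_eq_lintegral_ofReal (hint.const_mul D), integral_const_mul, key]
  · refine (ENNReal.ofReal_le_ofReal hl.le).trans ?_
    rw [ENNReal.ofReal_div_of_pos (by norm_num)]; simp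
  · filter_upwards [self_mem_ae_restrict measurableSet_Ioi] with x hx
    have : (0:ℝ) < x := hx
    show (0:ℝ) ≤ _
    positivity

lemma weak_gronwall (D θ a b : ℝ) (hD : 0 ≤ D) (hθ₁ : θ < 1) (hab : a < b)
    (φ : ℝ → ENNReal) (hm : AEMeasurable φ (volume.restrict (Set.Ioo a b)))
    (hfin : ∫⁻ x in Set.Ioo a b, φ x ≠ ⊤)
    (h : ∀ s ∈ Set.Ico a b, φ s ≤
      ∫⁻ x in Set.Ioo s b, ENNReal.ofReal (D * (x - s) ^ (-θ)) * φ x) : φ a = 0 := by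
  obtain ⟨l, hl, hk⟩ := exists_lam D θ hD hθ₁
  set κ : ℝ → ENNReal := (Set.Ioi (0:ℝ)).indicator
    (fun r => ENNReal.ofReal (D * (r ^ (-θ) * Real.exp (-(l * r))))) with hκ
  have hκm : Measurable κ := by
    apply Measurable.indicator _ measurableSet_Ioi
    fun_prop
  have hκi : ∫⁻ r, κ r ≤ 1 / 2 := by
    rw [hκ, lintegral_indicator measurableSet_Ioi]; exact hk
  set ψ : ℝ → ENNReal := fun x => ENNReal.ofReal (Real.exp (l * x)) * φ x with hψ
  have hψm : AEMeasurable ψ (volume.restrict (Set.Ioo a b)) := by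
    apply AEMeasurable.mul _ hm
    fun_prop
  have hψle : ∀ s ∈ Set.Ioo a b, ψ s ≤ ∫⁻ x in Set.Ioo a b, κ (x - s) * ψ x := by
    intro s hs
    calc ψ s ≤ ENNReal.ofReal (Real.exp (l * s)) *
          ∫⁻ x in Set.Ioo s b, ENNReal.ofReal (D * (x - s) ^ (-θ)) * φ x := by
          simp only [hψ]; gcongr; exact h s ⟨hs.1.le, hs.2⟩
      _ = ∫⁻ x in Set.Ioo s b, κ (x - s) * ψ x := by
          rw [← lintegral_const_mul' _ _ ENNReal.ofReal_ne_top]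
          refine setLIntegral_congr_fun measurableSet_Ioo fun x hx => ?_
          have hxs : 0 < x - s := by linarith [hx.1]
          simp only [hκ, hψ]
          rw [Set.indicator_of_mem (show x - s ∈ Set.Ioi (0:ℝ) from hxs), ← mul_assoc, ← mul_assoc,
            ← ENNReal.ofReal_mul (by positivity), ← ENNReal.ofReal_mul (by positivity)]
          congr 2
          have : Real.exp (l * s) = Real.exp (-(l * (x - s))) * Real.exp (l * x) := by
            rw [← Real.exp_add]; congr 1; ring
          rw [this]; ring
      _ ≤ _ := lintegral_mono_set (Set.Ioo_subset_Ioo_left hs.1.le)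
  have hI : ∫⁻ s in Set.Ioo a b, ψ s ≤ (1 / 2) * ∫⁻ s in Set.Ioo a b, ψ s := by
    calc ∫⁻ s in Set.Ioo a b, ψ s
        ≤ ∫⁻ s in Set.Ioo a b, ∫⁻ x in Set.Ioo a b, κ (x - s) * ψ x :=
          setLIntegral_mono' measurableSet_Ioo hψle
      _ = ∫⁻ x in Set.Ioo a b, ∫⁻ s in Set.Ioo a b, κ (x - s) * ψ x := by
          apply lintegral_lintegral_swap
          apply AEMeasurable.mul
          · exact (hκm.comp (measurable_snd.sub measurable_fst)).aemeasurable
          · exact hψm.comp_snd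
      _ ≤ ∫⁻ x in Set.Ioo a b, (1 / 2) * ψ x := by
          refine lintegral_mono fun x => ?_
          have hm2 : Measurable (fun s => κ (x - s)) :=
            hκm.comp (measurable_const.sub measurable_id)
          rw [lintegral_mul_const _ hm2]
          gcongr
          refine (setLIntegral_le_lintegral _ _).trans ?_
          rw [lintegral_sub_left_eq_self κ x]
          exact hκi
      _ = _ := by rw [lintegral_const_mul' _ _ (by simp)]
  have hIfin : ∫⁻ s in Set.Ioo a b, ψ s ≠ ⊤ := by
    refine ne_top_of_le_ne_top (ENNReal.mul_ne_top (ENNReal.ofReal_ne_top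
      (r := Real.exp (l * b))) hfin) ?_
    rw [← lintegral_const_mul' _ _ ENNReal.ofReal_ne_top]
    refine setLIntegral_mono' measurableSet_Ioo fun x hx => ?_
    simp only [hψ]
    have := hx.2
    gcongr
  have hI0 : ∫⁻ s in Set.Ioo a b, ψ s = 0 := by
    by_contra hne
    have hlt := ENNReal.half_lt_self hne hIfin
    rw [ENNReal.div_eq_inv_mul, ← one_div] at hlt
    exact absurd hI (not_le.2 hlt)
  rw [lintegral_eq_zero_iff' hψm] at hI0
  have := h a ⟨le_rfl, hab⟩
  rw [← nonpos_iff_eq_zero]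
  refine this.trans (le_of_eq ?_)
  rw [← lintegral_zero (μ := volume.restrict (Set.Ioo a b))]
  refine lintegral_congr_ae ?_
  filter_upwards [hI0] with x hx
  simp only [hψ, Pi.zero_apply, mul_eq_zero, ENNReal.ofReal_eq_zero] at hx
  rcases hx with hx | hx
  · exact absurd hx (not_le.2 (Real.exp_pos _))
  · simp [hx]

lemma core (δ θ D S ε s₀ : ℝ) (hδ : 0 < δ) (hθ₀ : 0 ≤ θ) (hθ₁ : θ < 1) (hs₀ : 0 < s₀)
    (c f G W : ℝ → ℝ) (hc : ∀ s : ℝ, 0 < s → 0 ≤ c s) (hcD : ∀ s : ℝ, 0 < s → c s ≤ D)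
    (hcc : ContinuousOn c (Set.Ioi 0)) (hGc : ContinuousOn G (Set.Ioi 0))
    (hWc : ContinuousOn W (Set.Ioi 0))
    (hf : ∀ s : ℝ, 0 < s → 0 ≤ f s) (hfi : LocallyIntegrableOn f (Set.Ioi 0) volume)
    (hfS : ∀ s, S ≤ s → f s ≤ ε)
    (hε : 0 < ε) (hG : ∀ s : ℝ, 0 < s → ε ≤ G s) (hW : ∀ s : ℝ, 0 < s → 1 ≤ W s)
    (hcon : ∀ s, 0 < s → ∫⁻ x in Set.Ioi s, ENNReal.ofReal
      (2 * G x * W x * c x * ((x - s) / x) ^ (-θ) * (x / s) ^ (-(3 * δ)) / x)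
      ≤ ENNReal.ofReal (G s * W s))
    (hineq : ∀ s : ℝ, 0 < s →
        f s ≤ G s + ∫ s' in Set.Ioi s,
          f s' * c s' * ((s' - s) / s') ^ (-θ) * (s' / s) ^ (-(3 * δ)) / s') :
    f s₀ ≤ 2 * G s₀ * W s₀ := by
  have hG0 : ∀ s : ℝ, 0 < s → 0 ≤ G s := fun s hs => hε.le.trans (hG s hs)
  have hW0 : ∀ s : ℝ, 0 < s → 0 ≤ W s := fun s hs => zero_le_one.trans (hW s hs)
  set φ : ℝ → ENNReal := fun x => ENNReal.ofReal (f x - 2 * G x * W x) with hφ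
  have hφS : ∀ s, 0 < s → S ≤ s → φ s = 0 := by
    intro s hs hS
    simp only [hφ, ENNReal.ofReal_eq_zero]
    nlinarith [hfS s hS, hG s hs, hW s hs, hG0 s hs]
  suffices φ s₀ = 0 by
    simp only [hφ, ENNReal.ofReal_eq_zero] at this
    linarith
  rcases le_or_gt S s₀ with hS | hS
  · exact hφS s₀ hs₀ hS
  have step1 : ∀ s, 0 < s → φ s ≤ ∫⁻ x in Set.Ioi s,
      ENNReal.ofReal (c x * ((x - s) / x) ^ (-θ) * (x / s) ^ (-(3 * δ)) / x) * φ x := by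
    intro s hs
    have hnn : ∀ x ∈ Set.Ioi s, 0 ≤ c x * ((x - s) / x) ^ (-θ) * (x / s) ^ (-(3 * δ)) / x := by
      intro x hx
      have hx0 : 0 < x := hs.trans hx
      have := hc x hx0
      have h2 : 0 < (x - s) / x := div_pos (sub_pos.2 hx) hx0
      positivity
    have b1 : ENNReal.ofReal (∫ s' in Set.Ioi s,
          f s' * c s' * ((s' - s) / s') ^ (-θ) * (s' / s) ^ (-(3 * δ)) / s') ≤
        ∫⁻ x in Set.Ioi s, ENNReal.ofReal
          (f x * (c x * ((x - s) / x) ^ (-θ) * (x / s) ^ (-(3 * δ)) / x)) := by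
      refine (Real.ofReal_le_enorm _).trans ((enorm_integral_le_lintegral_enorm _).trans ?_)
      refine setLIntegral_mono' measurableSet_Ioi fun x hx => ?_
      rw [show f x * c x * ((x - s) / x) ^ (-θ) * (x / s) ^ (-(3 * δ)) / x =
        f x * (c x * ((x - s) / x) ^ (-θ) * (x / s) ^ (-(3 * δ)) / x) by ring]
      rw [Real.enorm_of_nonneg (mul_nonneg (hf x (hs.trans hx)) (hnn x hx))]
    have b2 : ∫⁻ x in Set.Ioi s, ENNReal.ofReal
          (f x * (c x * ((x - s) / x) ^ (-θ) * (x / s) ^ (-(3 * δ)) / x)) ≤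
        ∫⁻ x in Set.Ioi s, (ENNReal.ofReal
          (2 * G x * W x * c x * ((x - s) / x) ^ (-θ) * (x / s) ^ (-(3 * δ)) / x) +
          ENNReal.ofReal (c x * ((x - s) / x) ^ (-θ) * (x / s) ^ (-(3 * δ)) / x) * φ x) := by
      refine setLIntegral_mono' measurableSet_Ioi fun x hx => ?_
      simp only [hφ]
      rw [← ENNReal.ofReal_mul (hnn x hx)]
      refine le_trans (ENNReal.ofReal_le_ofReal (le_of_eq ?_)) ENNReal.ofReal_add_le
      ring
    have hmeas : AEMeasurable (fun x => ENNReal.ofReal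
          (2 * G x * W x * c x * ((x - s) / x) ^ (-θ) * (x / s) ^ (-(3 * δ)) / x))
          (volume.restrict (Set.Ioi s)) := by
      have hsub : Set.Ioi s ⊆ Set.Ioi 0 := Set.Ioi_subset_Ioi hs.le
      have m1 := (hcc.mono hsub).aemeasurable measurableSet_Ioi (μ := volume)
      have m2 := (hGc.mono hsub).aemeasurable measurableSet_Ioi (μ := volume)
      have m3 := (hWc.mono hsub).aemeasurable measurableSet_Ioi (μ := volume)
      fun_prop
    rw [lintegral_add_left' hmeas] at b2
    have b3 : ENNReal.ofReal (f s) ≤ ENNReal.ofReal (2 * G s * W s) + ∫⁻ x in Set.Ioi s,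
        ENNReal.ofReal (c x * ((x - s) / x) ^ (-θ) * (x / s) ^ (-(3 * δ)) / x) * φ x := by
      refine (ENNReal.ofReal_le_ofReal (hineq s hs)).trans (ENNReal.ofReal_add_le.trans ?_)
      refine (add_le_add_right (b1.trans (b2.trans (add_le_add_left (hcon s hs) _))) _).trans ?_
      rw [← add_assoc]
      refine add_le_add_left ?_ _
      rw [← ENNReal.ofReal_add (hG0 s hs) (mul_nonneg (hG0 s hs) (hW0 s hs))]
      apply ENNReal.ofReal_le_ofReal
      nlinarith [hG0 s hs, hW s hs]
    simp only [hφ]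
    rw [ENNReal.ofReal_sub _ (by have := hG0 s hs; have := hW0 s hs; positivity)]
    exact tsub_le_iff_left.2 b3
  have hD0 : 0 ≤ D := (hc s₀ hs₀).trans (hcD s₀ hs₀)
  have hS0 : 0 < S := hs₀.trans hS
  have hsub : Set.Ioo s₀ S ⊆ Set.Ioi 0 := fun x hx => hs₀.trans hx.1
  have hfI : IntegrableOn f (Set.Ioo s₀ S) := by
    have : IntegrableOn f (Set.Icc s₀ S) :=
      hfi.integrableOn_compact_subset (fun x hx => hs₀.trans_le hx.1) isCompact_Icc
    exact this.mono_set Set.Ioo_subset_Icc_self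
  refine weak_gronwall (D * S ^ θ / s₀) θ s₀ S (by positivity) hθ₁ hS φ ?_ ?_ ?_
  · have m1 := hfI.aemeasurable
    have m2 := (hGc.mono hsub).aemeasurable measurableSet_Ioo (μ := volume)
    have m3 := (hWc.mono hsub).aemeasurable measurableSet_Ioo (μ := volume)
    simp only [hφ]
    fun_prop
  · refine ne_top_of_le_ne_top hfI.lintegral_lt_top.ne ?_
    refine setLIntegral_mono' measurableSet_Ioo fun x hx => ?_
    apply ENNReal.ofReal_le_ofReal
    have := mul_nonneg (hG0 x (hsub hx)) (hW0 x (hsub hx))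
    nlinarith
  · intro s hs
    have hs0 : 0 < s := hs₀.trans_le hs.1
    refine (step1 s hs0).trans ?_
    have e : ∫⁻ x in Set.Ioi s,
        ENNReal.ofReal (c x * ((x - s) / x) ^ (-θ) * (x / s) ^ (-(3 * δ)) / x) * φ x ≤
        ∫⁻ x in Set.Ioi s, (Set.Iio S).indicator (fun x =>
          ENNReal.ofReal (c x * ((x - s) / x) ^ (-θ) * (x / s) ^ (-(3 * δ)) / x) * φ x) x := by
      refine setLIntegral_mono' measurableSet_Ioi fun x hx => ?_
      by_cases hxS : x < S
      · rw [Set.indicator_of_mem (show x ∈ Set.Iio S from hxS)]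
      · rw [hφS x (hs0.trans hx) (not_lt.1 hxS), mul_zero]; exact zero_le
    refine e.trans ?_
    rw [setLIntegral_indicator measurableSet_Iio, Set.inter_comm, Set.Ioi_inter_Iio]
    refine setLIntegral_mono' measurableSet_Ioo fun x hx => ?_
    gcongr
    have hx0 : 0 < x := hs0.trans hx.1
    have hxs : 0 < x - s := sub_pos.2 hx.1
    have hv : (x / s) ^ (-(3 * δ)) ≤ 1 :=
      Real.rpow_le_one_of_one_le_of_nonpos (by rw [one_le_div hs0]; exact hx.1.le) (by linarith)
    have hy : ((x - s) / x) ^ (-θ) ≤ (x - s) ^ (-θ) * S ^ θ := by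
      rw [Real.div_rpow hxs.le hx0.le, Real.rpow_neg hx0.le, div_inv_eq_mul]
      have := hx.2.le
      gcongr
    have h1 := hcD x hx0
    have h2 := hc x hx0
    have h3 : s₀ ≤ x := hs.1.trans hx.1.le
    calc c x * ((x - s) / x) ^ (-θ) * (x / s) ^ (-(3 * δ)) / x
        ≤ D * ((x - s) ^ (-θ) * S ^ θ) * 1 / s₀ := by gcongr
      _ = _ := by ring

/-- Gronwall-type inequality from `s = +∞`: if
`f(s) ≤ g(s) + ∫_s^∞ f(s′) c(s′) ((s′−s)/s′)^{−θ} (s′/s)^{−3δ₀} ds′/s′`,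
`f → 0` at infinity and `g` obeys the envelope fluctuation bound, then `f ≲_{E,θ,δ₀} g`. -/
theorem gronwall_from_infinity (δ₀ : ℝ) (hδ₀ : 0 < δ₀) (hδ₀' : δ₀ ≤ 1 / 100)
    (E θ : ℝ) (hE : 0 < E) (hθ₀ : 0 ≤ θ) (hθ₁ : θ < 1) :
    ∃ C > (0 : ℝ), ∀ c f g : ℝ → ℝ,
      IsFreqEnvelopeLE δ₀ E c →
      (∀ s : ℝ, 0 < s → 0 ≤ f s) →
      (∀ s : ℝ, 0 < s → 0 ≤ g s) →
      LocallyIntegrableOn f (Set.Ioi 0) volume →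
      LocallyIntegrableOn g (Set.Ioi 0) volume →
      Filter.Tendsto f Filter.atTop (nhds 0) →
      (∀ s : ℝ, 0 < s → ∀ s' : ℝ, 0 < s' →
        g s' ≤ max ((s' / s) ^ δ₀) ((s / s') ^ δ₀) * g s) →
      (∀ s : ℝ, 0 < s →
        f s ≤ g s + ∫ s' in Set.Ioi s,
          f s' * c s' * ((s' - s) / s') ^ (-θ) * (s' / s) ^ (-(3 * δ₀)) / s') →
      ∀ s : ℝ, 0 < s → f s ≤ C * g s := by

  obtain ⟨n, hn⟩ := exists_nat_gt (θ / (1 - θ))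
  have h1θ : 0 < 1 - θ := by linarith
  have hn0' : (0:ℝ) < n := lt_of_le_of_lt (by positivity) hn
  have hn0 : 0 < n := by exact_mod_cast hn0'
  obtain ⟨a, ha⟩ : ∃ a, a = θ * (((n:ℝ) + 1) / n) := ⟨_, rfl⟩
  have ha1 : a < 1 := by
    rw [div_lt_iff₀ h1θ] at hn
    rw [ha, ← mul_div_assoc, div_lt_one hn0']
    linarith
  obtain ⟨η, hη⟩ : ∃ η, η = (1 - a) * (2 * δ₀) / 4 := ⟨_, rfl⟩
  obtain ⟨A, hA⟩ : ∃ A, A = 4 * (η⁻¹) ^ n := ⟨_, rfl⟩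
  have h1a : 0 < 1 - a := by linarith
  have hη0 : 0 < η := by rw [hη]; positivity
  have hA0 : 0 < A := by rw [hA]; positivity
  refine ⟨2 * Real.exp (A * (Real.sqrt (8 * E) ^ (n - 1) * E)), by positivity, ?_⟩
  rintro c f g ⟨hc0, hci, hcE, hcc⟩ hf0 hg0 hfi hgi hft hgg hineq s hs
  have hcD : ∀ s : ℝ, 0 < s → c s ≤ Real.sqrt (8 * E) := fun s hs =>
    Real.le_sqrt_of_sq_le (env_bdd δ₀ E hδ₀ (by linarith) c hc0 hci hcE hcc s hs)
  have hccont := env_cont δ₀ c hcc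
  have hgcont := env_cont δ₀ g hgg
  have hucont : ContinuousOn (fun x => c x ^ (n + 1) / x) (Set.Ioi 0) :=
    (hccont.pow _).div continuousOn_id (fun x hx => (ne_of_gt hx))
  have hu0 : ∀ x : ℝ, 0 < x → 0 ≤ c x ^ (n + 1) / x := fun x hx => by
    have := hc0 x hx
    positivity
  have hule : ∀ x : ℝ, 0 < x → c x ^ (n + 1) / x ≤ Real.sqrt (8 * E) ^ (n - 1) * (c x ^ 2 / x) := by
    intro x hx
    have h1 := hcD x hx
    have h2 := hc0 x hx
    rw [show n + 1 = (n - 1) + 2 by omega, pow_add, ← mul_div_assoc]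
    gcongr
  have hui : IntegrableOn (fun x => c x ^ (n + 1) / x) (Set.Ioi 0) := by
    refine Integrable.mono' (hci.const_mul (Real.sqrt (8 * E) ^ (n - 1)))
      (hucont.aestronglyMeasurable measurableSet_Ioi) ?_
    filter_upwards [self_mem_ae_restrict measurableSet_Ioi] with x hx
    rw [Real.norm_of_nonneg (hu0 x hx)]
    exact hule x hx
  have huE : ∫ x in Set.Ioi 0, c x ^ (n + 1) / x ≤ Real.sqrt (8 * E) ^ (n - 1) * E := by
    refine (setIntegral_mono_on hui (hci.const_mul (Real.sqrt (8 * E) ^ (n - 1)))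
      measurableSet_Ioi hule).trans ?_
    rw [integral_const_mul]
    gcongr
  obtain ⟨W, hWc, hWb, hWW, hWi⟩ := W_int _ A hA0 hucont hu0 hui
  have hmain : ∀ ε : ℝ, 0 < ε → f s ≤ 2 * (g s + ε) * W s := by
    intro ε hε
    obtain ⟨S, hS⟩ := Filter.eventually_atTop.1 (hft.eventually (gt_mem_nhds hε))
    refine core δ₀ θ (Real.sqrt (8 * E)) S ε s hδ₀ hθ₀ hθ₁ hs c f (fun x => g x + ε) W hc0 hcD
      hccont (hgcont.add continuousOn_const) hWc hf0 hfi (fun x hx => (hS x hx).le) hε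
      (fun x hx => by have := hg0 x hx; simpa using this) (fun x hx => (hWb x hx).1) ?_
      (fun x hx => by have := hineq x hx; linarith)
    intro t ht
    refine contraction δ₀ θ a η A n hn0 hδ₀ (by linarith) hθ₀ ha ha1 hη hA c (fun x => g x + ε) W
      hc0 (fun x hx => add_nonneg (hg0 x hx) hε.le) (fun x hx => zero_le_one.trans (hWb x hx).1)
      ?_ hWW hWi t ht
    intro x y hx hxy
    have hy : 0 < y := hx.trans_le hxy
    have h1 : 1 ≤ (y / x) ^ δ₀ := Real.one_le_rpow (by rw [one_le_div hx]; exact hxy) hδ₀.le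
    have h2 : (x / y) ^ δ₀ ≤ 1 :=
      Real.rpow_le_one (by positivity) (by rw [div_le_one hy]; exact hxy) hδ₀.le
    have h3 := hgg x hx y hy
    rw [max_eq_left (h2.trans h1)] at h3
    nlinarith
  have hlim : f s ≤ 2 * g s * W s := by
    refine le_of_forall_pos_le_add fun ε hε => ?_
    have hW1 := (hWb s hs).1
    have hWp : 0 < W s := by linarith
    have := hmain (ε / (2 * W s)) (by positivity)
    have e : 2 * (g s + ε / (2 * W s)) * W s = 2 * g s * W s + ε := by field_simp
    linarith
  have hWC : W s ≤ Real.exp (A * (Real.sqrt (8 * E) ^ (n - 1) * E)) := by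
    refine (hWb s hs).2.trans ?_
    gcongr
  have hgs := hg0 s hs
  calc f s ≤ 2 * g s * W s := hlim
    _ ≤ 2 * g s * Real.exp (A * (Real.sqrt (8 * E) ^ (n - 1) * E)) := by gcongr
    _ = _ := by ring
end
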